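/- arXiv:0710.2932 — 3 statements merged into one kernel-verified Lean document; each statement's English description precedes it below -/
import Mathlib

section
/- The map sending a permutation π ∈ S_{{±1,...,±n}} with π(-i) = -π(i) for all i to itself is an embedding of the type B_n Weyl group (signed permutations on n letters) into S_{2n}, and the Bruhat order on B_n agrees with the restriction of the Bruhat order on S_{2n} to the image of this embedding. -/
/-- The word length of `g` with respect to a generating set `S`. -/
noncomputable def genLength {G : Type*} [Group G] (S : Set G) (g : G) : ℕ :=
  sInf {k | ∃ l : List G, l.length = k ∧ (∀ x ∈ l, x ∈ S) ∧ l.prod = g}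

/-- A reflection: a conjugate of a generator by a product of generators. -/
def IsGenReflection {G : Type*} [Group G] (S : Set G) (t : G) : Prop :=
  ∃ l : List G, (∀ x ∈ l, x ∈ S) ∧ ∃ s ∈ S, t = l.prod * s * l.prod⁻¹

/-- Bruhat order with respect to a set of Coxeter generators `S`: generated by
`u < u·t` for reflections `t` which increase the length. -/
def bruhatLE {G : Type*} [Group G] (S : Set G) : G → G → Prop :=
  Relation.ReflTransGen
    (fun u v => ∃ t, IsGenReflection S t ∧ v = u * t ∧ genLength S u < genLength S v)

/-- We identify `S_{2n}` with `Equiv.Perm (Fin (2*n))`, the linearly ordered set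
`Fin (2*n)` standing for `{-n, …, -1, 1, …, n}`, with negation given by `Fin.rev`.
A signed permutation is a permutation commuting with this negation. -/
def IsSignedPerm {n : ℕ} (π : Equiv.Perm (Fin (2 * n))) : Prop :=
  ∀ i, π i.rev = (π i).rev

/-- The simple generators of `S_{2n}`: adjacent transpositions. -/
def simplesA (n : ℕ) : Set (Equiv.Perm (Fin (2 * n))) :=
  {σ | ∃ i : ℕ, ∃ h : i + 1 < 2 * n, σ = Equiv.swap ⟨i, by omega⟩ ⟨i + 1, h⟩}

/-- The simple generators of the type `B_n` Weyl group, realized inside `S_{2n}`: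
`s_0 = (1,-1)` (swapping the two middle positions), and for `1 ≤ i ≤ n-1` the signed
transpositions `(i, i+1)(-i, -(i+1))`. -/
def simplesB (n : ℕ) : Set (Equiv.Perm (Fin (2 * n))) :=
  {σ | (∃ h : n < 2 * n, σ = Equiv.swap ⟨n - 1, by omega⟩ ⟨n, h⟩) ∨
    (∃ i : ℕ, ∃ _h1 : 1 ≤ i, ∃ _h2 : i ≤ n - 1, ∃ _h3 : 1 ≤ n,
      σ = Equiv.swap ⟨n + i - 1, by omega⟩ ⟨n + i, by omega⟩ *
          Equiv.swap ⟨n - i - 1, by omega⟩ ⟨n - i, by omega⟩)}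

open Equiv

namespace SPB

abbrev P (n : ℕ) := Equiv.Perm (Fin (2 * n))

/-! ### Generic exchange argument -/

theorem exchange {n : ℕ} (S : Set (P n)) (T : Fin (2*n) → Fin (2*n) → P n)
    (hsq : ∀ s ∈ S, s * s = 1)
    (hflip : ∀ s ∈ S, ∀ p q, p < q → s q < s p → s = T p q)
    (hconj : ∀ l : List (P n), (∀ x ∈ l, x ∈ S) → ∀ p q, p ≠ q →
      l.prod * T p q = T (l.prod p) (l.prod q) * l.prod)
    (i j : Fin (2*n)) (hij : i < j) (l : List (P n)) (hl : ∀ x ∈ l, x ∈ S)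
    (h : l.prod j < l.prod i) :
    ∃ l' : List (P n), (∀ x ∈ l', x ∈ S) ∧ l'.length + 1 = l.length ∧ l'.prod = l.prod * T i j := by
  induction l with
  | nil => simp at h; exact absurd h (not_lt.mpr hij.le)
  | cons s l ih =>
    have hs : s ∈ S := hl s (by simp)
    have hl' : ∀ x ∈ l, x ∈ S := fun x hx => hl x (by simp [hx])
    by_cases h' : l.prod j < l.prod i
    · obtain ⟨m, hm, hlen, hp⟩ := ih hl' h'
      refine ⟨s :: m, ?_, by simp [hlen], by simp [hp, mul_assoc]⟩
      intro x hx
      rcases List.mem_cons.mp hx with rfl | hx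
      · exact hs
      · exact hm x hx
    · have hne : l.prod i ≠ l.prod j := fun e => hij.ne (l.prod.injective e)
      have hlt : l.prod i < l.prod j := lt_of_le_of_ne (not_lt.mp h') hne
      have e := hflip s hs _ _ hlt (by simpa using h)
      refine ⟨l, hl', by simp, ?_⟩
      rw [List.prod_cons, mul_assoc, hconj l hl' i j hij.ne, ← e, ← mul_assoc, hsq s hs, one_mul]

def Gen {n : ℕ} (S : Set (P n)) (g : P n) : Prop := ∃ l : List (P n), (∀ x ∈ l, x ∈ S) ∧ l.prod = g

theorem Gen.mul {n : ℕ} {S : Set (P n)} {g h : P n} (hg : Gen S g) (hh : Gen S h) : Gen S (g * h) := by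
  obtain ⟨l, hl, rfl⟩ := hg
  obtain ⟨m, hm, rfl⟩ := hh
  refine ⟨l ++ m, ?_, by simp⟩
  intro x hx
  rcases List.mem_append.mp hx with hx | hx
  · exact hl x hx
  · exact hm x hx

theorem Gen.one {n : ℕ} {S : Set (P n)} : Gen S 1 := ⟨[], by simp, rfl⟩

theorem Gen.of {n : ℕ} {S : Set (P n)} {s : P n} (h : s ∈ S) : Gen S s := ⟨[s], by simpa using h, by simp⟩

theorem Gen.inv {n : ℕ} {S : Set (P n)} (hsq : ∀ s ∈ S, s * s = 1) {g : P n} (hg : Gen S g) :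
    Gen S g⁻¹ := by
  obtain ⟨l, hl, rfl⟩ := hg
  induction l with
  | nil => simpa using Gen.one
  | cons s l ih =>
    have hs : s ∈ S := hl s (by simp)
    rw [List.prod_cons, mul_inv_rev, inv_eq_of_mul_eq_one_left (hsq s hs)]
    exact (ih (fun x hx => hl x (by simp [hx]))).mul (Gen.of hs)

theorem refl_gen {n : ℕ} {S : Set (P n)} (hsq : ∀ s ∈ S, s * s = 1) {t : P n}
    (ht : IsGenReflection S t) : Gen S t := by
  obtain ⟨l, hl, s, hs, rfl⟩ := ht
  have hg : Gen S l.prod := ⟨l, hl, rfl⟩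
  exact (hg.mul (Gen.of hs)).mul (hg.inv hsq)

theorem refl_of {n : ℕ} {S : Set (P n)} {s : P n} (hs : s ∈ S) : IsGenReflection S s :=
  ⟨[], by simp, s, hs, by simp⟩

theorem refl_conj {n : ℕ} {S : Set (P n)} {s t : P n} (hs : s ∈ S) (ht : IsGenReflection S t) :
    IsGenReflection S (s * t * s⁻¹) := by
  obtain ⟨l, hl, r, hr, rfl⟩ := ht
  refine ⟨s :: l, ?_, r, hr, by simp [mul_assoc]⟩
  intro x hx
  rcases List.mem_cons.mp hx with rfl | hx
  · exact hs
  · exact hl x hx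

theorem len_le {n : ℕ} {S : Set (P n)} (l : List (P n)) (hl : ∀ x ∈ l, x ∈ S) :
    genLength S l.prod ≤ l.length := Nat.sInf_le ⟨l, rfl, hl, rfl⟩

theorem len_attained {n : ℕ} {S : Set (P n)} {g : P n} (hg : Gen S g) :
    ∃ l : List (P n), (∀ x ∈ l, x ∈ S) ∧ l.length = genLength S g ∧ l.prod = g := by
  obtain ⟨l, hl, hp⟩ := hg
  have : genLength S g ∈ {k | ∃ l : List (P n), l.length = k ∧ (∀ x ∈ l, x ∈ S) ∧ l.prod = g} :=
    Nat.sInf_mem ⟨l.length, l, rfl, hl, hp⟩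
  obtain ⟨m, h1, h2, h3⟩ := this
  exact ⟨m, h2, h1, h3⟩

theorem len_lt {n : ℕ} (S : Set (P n)) (T : Fin (2*n) → Fin (2*n) → P n)
    (hsq : ∀ s ∈ S, s * s = 1)
    (hflip : ∀ s ∈ S, ∀ p q, p < q → s q < s p → s = T p q)
    (hconj : ∀ l : List (P n), (∀ x ∈ l, x ∈ S) → ∀ p q, p ≠ q →
      l.prod * T p q = T (l.prod p) (l.prod q) * l.prod)
    (i j : Fin (2*n)) (hij : i < j) (u : P n) (hu : Gen S u) (h : u j < u i) :
    genLength S (u * T i j) < genLength S u := by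
  obtain ⟨l, hl, hlen, rfl⟩ := len_attained hu
  obtain ⟨m, hm, hml, hmp⟩ := exchange S T hsq hflip hconj i j hij l hl h
  rw [← hmp]
  have := len_le m hm
  omega

/-! ### Type A -/

theorem sqA {n : ℕ} : ∀ s ∈ simplesA n, s * s = 1 := by
  rintro s ⟨i, h, rfl⟩
  simp

theorem flipA {n : ℕ} : ∀ s ∈ simplesA n, ∀ p q, p < q → s q < s p → s = swap p q := by
  rintro s ⟨i, h, rfl⟩ p q hpq hs
  have : p.val = i ∧ q.val = i + 1 := by
    rw [swap_apply_def, swap_apply_def] at hs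
    simp only [Fin.ext_iff, Fin.lt_def] at *
    split_ifs at hs <;> (try simp only [] at hs) <;> omega
  obtain ⟨h1, h2⟩ := this
  congr 1 <;> ext <;> simp [h1, h2]

theorem conjA {n : ℕ} (g : P n) (p q : Fin (2*n)) : g * swap p q = swap (g p) (g q) * g := by
  rw [swap_apply_apply]; simp

theorem reflA {n : ℕ} (d : ℕ) : ∀ i j : Fin (2*n), j.val = i.val + 1 + d →
    IsGenReflection (simplesA n) (swap i j) := by
  induction d with
  | zero =>
    intro i j h
    refine refl_of ⟨i.val, by omega, ?_⟩
    congr 1; ext; simp [h]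
  | succ d ih =>
    intro i j h
    have hk : i.val + 1 + d < 2 * n := by omega
    have hs : swap (⟨i.val + 1 + d, hk⟩ : Fin (2*n)) j ∈ simplesA n := by
      refine ⟨i.val + 1 + d, by omega, ?_⟩
      congr 1; ext; simp [h]; omega
    have := refl_conj hs (ih i ⟨i.val + 1 + d, hk⟩ rfl)
    rw [← swap_apply_apply, swap_apply_left, swap_apply_of_ne_of_ne] at this
    · exact this
    · rw [Ne, Fin.ext_iff]; simp; omega
    · rw [Ne, Fin.ext_iff]; omega

theorem reflA' {n : ℕ} {i j : Fin (2*n)} (h : i < j) : IsGenReflection (simplesA n) (swap i j) :=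
  reflA (j.val - i.val - 1) i j (by rw [Fin.lt_def] at h; omega)

theorem reflA_form {n : ℕ} {t : P n} (h : IsGenReflection (simplesA n) t) :
    ∃ i j, i < j ∧ t = swap i j := by
  obtain ⟨l, hl, s, ⟨i, hi, rfl⟩, rfl⟩ := h
  rw [← swap_apply_apply]
  set p := l.prod ⟨i, by omega⟩ with hp
  set q := l.prod ⟨i+1, hi⟩ with hq
  have : p ≠ q := by
    intro e
    have := l.prod.injective e
    simp at this
  rcases lt_or_gt_of_ne this with h | h
  · exact ⟨p, q, h, rfl⟩
  · exact ⟨q, p, h, swap_comm _ _⟩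

theorem genA {n : ℕ} (g : P n) : Gen (simplesA n) g := by
  induction g using Perm.swap_induction_on with
  | one => exact Gen.one
  | swap_mul f x y hxy hf =>
    refine Gen.mul ?_ hf
    rcases lt_or_gt_of_ne hxy with h | h
    · exact refl_gen sqA (reflA' h)
    · rw [swap_comm]; exact refl_gen sqA (reflA' h)

theorem lenA_lt {n : ℕ} (i j : Fin (2*n)) (hij : i < j) (u : P n) (h : u j < u i) :
    genLength (simplesA n) (u * swap i j) < genLength (simplesA n) u :=
  len_lt _ (fun p q => swap p q) sqA flipA (fun l _ p q _ => conjA _ p q) i j hij u (genA u) h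

theorem stepA {n : ℕ} (i j : Fin (2*n)) (hij : i < j) (u : P n) (h : u i < u j) :
    bruhatLE (simplesA n) u (u * swap i j) := by
  refine Relation.ReflTransGen.single ⟨swap i j, reflA' hij, rfl, ?_⟩
  have := lenA_lt i j hij (u * swap i j) (by simpa using h)
  simpa [mul_assoc] using this

/-! ### Type B -/

def T {n : ℕ} (i j : Fin (2*n)) : P n :=
  if j = i.rev then swap i j else swap i j * swap i.rev j.rev

theorem rev_ne {n : ℕ} (i : Fin (2*n)) : i.rev ≠ i := by
  rw [Ne, Fin.ext_iff, Fin.val_rev]; omega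

theorem T_apply {n : ℕ} {i j : Fin (2*n)} (hij : i ≠ j) (x : Fin (2*n)) :
    T i j x = if x = i then j else if x = j then i else if x = i.rev then j.rev
      else if x = j.rev then i.rev else x := by
  have hi := rev_ne i
  have hj := rev_ne j
  unfold T
  split_ifs <;> simp only [Perm.mul_apply, swap_apply_def, Fin.ext_iff, Fin.val_rev] at * <;>
    split_ifs <;> (try simp only [Fin.val_rev] at *) <;> omega

theorem T_signed {n : ℕ} {i j : Fin (2*n)} (hij : i ≠ j) : IsSignedPerm (T i j) := by
  intro x
  rw [T_apply hij, T_apply hij]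
  have hi := rev_ne i
  have hj := rev_ne j
  simp only [Fin.ext_iff, Fin.val_rev, Ne] at *
  split_ifs <;> (try simp only [Fin.val_rev] at *) <;> omega

theorem T_comm {n : ℕ} {i j : Fin (2*n)} (hij : i ≠ j) : T i j = T j i := by
  ext x
  rw [T_apply hij, T_apply hij.symm]
  simp only [Fin.ext_iff, Ne] at *
  split_ifs <;> (try simp only [Fin.val_rev] at *) <;> omega

theorem T_rev {n : ℕ} {i j : Fin (2*n)} (hij : i ≠ j) : T i.rev j.rev = T i j := by
  have : i.rev ≠ j.rev := fun e => hij (Fin.rev_injective e)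
  ext x
  rw [T_apply hij, T_apply this]
  simp only [Fin.ext_iff, Fin.val_rev, Ne] at *
  split_ifs <;> (try simp only [Fin.val_rev] at *) <;> omega

theorem T_sq {n : ℕ} {i j : Fin (2*n)} (hij : i ≠ j) : T i j * T i j = 1 := by
  ext x
  rw [Perm.mul_apply, T_apply hij x, Perm.one_apply]
  split_ifs <;> rw [T_apply hij] <;> simp only [Fin.ext_iff, Fin.val_rev, Ne] at * <;>
    split_ifs <;> (try simp only [Fin.val_rev] at *) <;> omega

theorem T_conj {n : ℕ} (g : P n) (hg : IsSignedPerm g) {p q : Fin (2*n)} (h : p ≠ q) :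
    g * T p q = T (g p) (g q) * g := by
  unfold T
  rw [← hg p, ← hg q]
  simp only [g.injective.eq_iff, ← hg p]
  split_ifs
  · exact conjA g p q
  · rw [← mul_assoc, conjA g p q, mul_assoc, conjA g p.rev q.rev, mul_assoc]

theorem simplesB_form {n : ℕ} {s : P n} (hs : s ∈ simplesB n) :
    ∃ i j : Fin (2*n), j.val = i.val + 1 ∧ s = T i j := by
  rcases hs with ⟨h, rfl⟩ | ⟨i, h1, h2, h3, rfl⟩
  · refine ⟨⟨n-1, by omega⟩, ⟨n, h⟩, by simp; omega, ?_⟩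
    unfold T
    rw [if_pos]
    rw [Fin.ext_iff, Fin.val_rev]; simp; omega
  · refine ⟨⟨n+i-1, by omega⟩, ⟨n+i, by omega⟩, by simp; omega, ?_⟩
    unfold T
    rw [if_neg]
    · congr 1
      rw [swap_comm]
      congr 1 <;> rw [Fin.ext_iff, Fin.val_rev] <;> simp <;> omega
    · rw [Fin.ext_iff, Fin.val_rev]; simp; omega

theorem simplesB_mem {n : ℕ} {i j : Fin (2*n)} (h : j.val = i.val + 1) : T i j ∈ simplesB n := by
  have key : ∀ i j : Fin (2*n), j.val = i.val + 1 → n ≤ i.val → T i j ∈ simplesB n := by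
    intro i j h hi
    right
    refine ⟨i.val - n + 1, by omega, by omega, by omega, ?_⟩
    unfold T
    rw [if_neg]
    · congr 1
      · congr 1 <;> rw [Fin.ext_iff] <;> simp <;> omega
      · rw [swap_comm]
        congr 1 <;> rw [Fin.ext_iff, Fin.val_rev] <;> simp <;> omega
    · rw [Fin.ext_iff, Fin.val_rev]; omega
  have hne : i ≠ j := by rw [Ne, Fin.ext_iff]; omega
  rcases lt_trichotomy (i.val + 1) n with h1 | h1 | h1
  · rw [← T_rev hne, T_comm (fun e => hne (Fin.rev_injective e))]
    apply key <;> simp only [Fin.val_rev] <;> omega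
  · left
    refine ⟨by omega, ?_⟩
    unfold T
    rw [if_pos]
    · congr 1 <;> rw [Fin.ext_iff] <;> simp <;> omega
    · rw [Fin.ext_iff, Fin.val_rev]; omega
  · exact key i j h (by omega)

theorem sqB {n : ℕ} : ∀ s ∈ simplesB n, s * s = 1 := by
  intro s hs
  obtain ⟨i, j, h, rfl⟩ := simplesB_form hs
  exact T_sq (by rw [Ne, Fin.ext_iff]; omega)

theorem flipB {n : ℕ} : ∀ s ∈ simplesB n, ∀ p q, p < q → s q < s p → s = T p q := by
  intro s hs p q hpq h
  obtain ⟨i, j, hij, rfl⟩ := simplesB_form hs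
  have hne : i ≠ j := by rw [Ne, Fin.ext_iff]; omega
  have : (p = i ∧ q = j) ∨ (p = j.rev ∧ q = i.rev) := by
    rw [T_apply hne, T_apply hne] at h
    simp only [Fin.ext_iff, Fin.lt_def, Fin.val_rev, Ne] at *
    split_ifs at h <;> (try simp only [Fin.val_rev] at *) <;> omega
  rcases this with ⟨rfl, rfl⟩ | ⟨rfl, rfl⟩
  · rfl
  · rw [T_rev hne.symm, T_comm hne]

theorem signed_one {n : ℕ} : IsSignedPerm (1 : P n) := fun _ => rfl

theorem signed_mul {n : ℕ} {u v : P n} (hu : IsSignedPerm u) (hv : IsSignedPerm v) :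
    IsSignedPerm (u * v) := fun i => by
  rw [Perm.mul_apply, hv, hu, Perm.mul_apply]

theorem signed_inv {n : ℕ} {u : P n} (hu : IsSignedPerm u) : IsSignedPerm u⁻¹ := fun i => by
  apply u.injective
  rw [hu]; simp

theorem signed_list {n : ℕ} (l : List (P n)) (hl : ∀ x ∈ l, x ∈ simplesB n) :
    IsSignedPerm l.prod := by
  induction l with
  | nil => exact signed_one
  | cons s l ih =>
    rw [List.prod_cons]
    refine signed_mul ?_ (ih (fun x hx => hl x (by simp [hx])))
    obtain ⟨i, j, h, rfl⟩ := simplesB_form (hl s (by simp))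
    exact T_signed (by rw [Ne, Fin.ext_iff]; omega)

theorem reflB {n : ℕ} (d : ℕ) : ∀ i j : Fin (2*n), i < j → j.val - i.val ≤ d →
    IsGenReflection (simplesB n) (T i j) := by
  induction d with
  | zero => intro i j h h'; rw [Fin.lt_def] at h; omega
  | succ d ih =>
    intro i j h hd
    rw [Fin.lt_def] at h
    by_cases h1 : j.val = i.val + 1
    · exact refl_of (simplesB_mem h1)
    -- conjugating by a simple `s` moving `i, j` to `p, q`
    have key : ∀ a b p q : Fin (2*n), b.val = a.val + 1 → p < q → q.val - p.val ≤ d →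
        T a b p = i → T a b q = j → IsGenReflection (simplesB n) (T i j) := by
      intro a b p q hab hpq hd hp hq
      have hne : a ≠ b := by rw [Ne, Fin.ext_iff]; omega
      have := refl_conj (simplesB_mem hab) (ih p q hpq hd)
      rw [T_conj _ (T_signed hne) hpq.ne, hp, hq] at this
      simpa using this
    by_cases h2 : j = i.rev
    · have h2' : j.val = 2 * n - (i.val + 1) := by rw [h2, Fin.val_rev]
      have hne : i ≠ (⟨i.val+1, by omega⟩ : Fin (2*n)) := by rw [Ne, Fin.ext_iff]; simp
      refine key i ⟨i.val+1, by omega⟩ ⟨i.val+1, by omega⟩ ⟨j.val-1, by omega⟩ rfl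
        (by rw [Fin.lt_def]; simp; omega) (by simp; omega) ?_ ?_ <;>
      · rw [T_apply hne]
        simp only [Fin.ext_iff, Fin.val_rev]
        split_ifs <;> (try simp only [Fin.val_rev] at *) <;> omega
    by_cases h3 : j.val = 2 * n - (i.val + 2)
    · have hne : (⟨j.val-1, by omega⟩ : Fin (2*n)) ≠ j := by rw [Ne, Fin.ext_iff]; simp; omega
      refine key ⟨j.val-1, by omega⟩ j i ⟨j.val-1, by omega⟩ (by simp; omega)
        (by rw [Fin.lt_def]; simp; omega) (by simp; omega) ?_ ?_ <;>
      · rw [T_apply hne]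
        simp only [Fin.ext_iff, Fin.val_rev] at *
        split_ifs <;> (try simp only [Fin.val_rev] at *) <;> omega
    · have hne : i ≠ (⟨i.val+1, by omega⟩ : Fin (2*n)) := by rw [Ne, Fin.ext_iff]; simp
      refine key i ⟨i.val+1, by omega⟩ ⟨i.val+1, by omega⟩ j rfl
        (by rw [Fin.lt_def]; simp; omega) (by simp; omega) ?_ ?_ <;>
      · rw [T_apply hne]
        simp only [Fin.ext_iff, Fin.val_rev] at *
        split_ifs <;> (try simp only [Fin.val_rev] at *) <;> omega

theorem reflB' {n : ℕ} {i j : Fin (2*n)} (h : i < j) : IsGenReflection (simplesB n) (T i j) :=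
  reflB _ i j h le_rfl

theorem reflB_form {n : ℕ} {t : P n} (h : IsGenReflection (simplesB n) t) :
    ∃ i j, i < j ∧ t = T i j := by
  obtain ⟨l, hl, s, hs, rfl⟩ := h
  obtain ⟨i, j, hij, rfl⟩ := simplesB_form hs
  have hne : i ≠ j := by rw [Ne, Fin.ext_iff]; omega
  rw [T_conj _ (signed_list l hl) hne, mul_inv_cancel_right]
  have : l.prod i ≠ l.prod j := fun e => hne (l.prod.injective e)
  rcases lt_or_gt_of_ne this with h | h
  · exact ⟨_, _, h, rfl⟩
  · exact ⟨_, _, h, T_comm this⟩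

theorem genT {n : ℕ} {i j : Fin (2*n)} (h : i ≠ j) : Gen (simplesB n) (T i j) := by
  rcases lt_or_gt_of_ne h with h' | h'
  · exact refl_gen sqB (reflB' h')
  · rw [T_comm h]; exact refl_gen sqB (reflB' h')

theorem genB {n : ℕ} (k : ℕ) : ∀ g : P n, IsSignedPerm g → g.support.card ≤ k →
    Gen (simplesB n) g := by
  induction k with
  | zero =>
    intro g _ h
    have : g = 1 := by simpa using h
    rw [this]; exact Gen.one
  | succ k ih =>
    intro g hg hk
    by_cases h1 : g = 1
    · rw [h1]; exact Gen.one
    obtain ⟨i, hi⟩ : ∃ i, g i ≠ i := by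
      by_contra! h
      exact h1 (Equiv.ext h)
    have hTs := T_signed hi.symm
    have hsub : (T i (g i) * g).support ⊂ g.support := by
      rw [Finset.ssubset_iff_of_subset]
      · refine ⟨i, by simpa using hi, ?_⟩
        simp [T_apply hi.symm, hi]
      · intro x hx
        rw [Perm.mem_support] at hx ⊢
        intro hgx
        apply hx
        rw [Perm.mul_apply, hgx, T_apply hi.symm, if_neg, if_neg, if_neg, if_neg]
        · rintro rfl
          rw [← hg, g.injective.eq_iff, hg, ] at hgx
          exact hi (Fin.rev_injective hgx)
        · rintro rfl
          rw [hg] at hgx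
          exact hi (Fin.rev_injective hgx)
        · rintro rfl
          exact hi (g.injective hgx)
        · rintro rfl
          exact hi hgx
    have := ih _ (signed_mul hTs hg) (by have := Finset.card_lt_card hsub; omega)
    have h2 := (genT hi.symm).mul this
    rwa [← mul_assoc, T_sq hi.symm, one_mul] at h2

theorem genB' {n : ℕ} {g : P n} (hg : IsSignedPerm g) : Gen (simplesB n) g := genB _ g hg le_rfl

theorem lenB_lt {n : ℕ} (i j : Fin (2*n)) (hij : i < j) (u : P n) (hu : IsSignedPerm u)
    (h : u j < u i) :
    genLength (simplesB n) (u * T i j) < genLength (simplesB n) u :=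
  len_lt _ T sqB flipB (fun l hl _ _ hpq => T_conj _ (signed_list l hl) hpq) i j hij u (genB' hu) h

theorem stepB {n : ℕ} (i j : Fin (2*n)) (hij : i < j) (u : P n) (hu : IsSignedPerm u)
    (h : u i < u j) :
    bruhatLE (simplesB n) u (u * T i j) := by
  refine Relation.ReflTransGen.single ⟨T i j, reflB' hij, rfl, ?_⟩
  have := lenB_lt i j hij (u * T i j) (signed_mul hu (T_signed hij.ne))
    (by simpa [T_apply hij.ne, hij.ne'] using h)
  simpa [mul_assoc, T_sq hij.ne] using this

theorem stepB_A {n : ℕ} (i j : Fin (2*n)) (hij : i < j) (u : P n) (hu : IsSignedPerm u)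
    (h : u i < u j) : bruhatLE (simplesA n) u (u * T i j) := by
  unfold T
  split_ifs with hr
  · exact stepA i j hij u h
  · rw [← mul_assoc]
    refine Relation.ReflTransGen.trans (stepA i j hij u h) ?_
    rw [swap_comm i.rev]
    have hi := rev_ne i
    have hj := rev_ne j
    have hr' : i ≠ j.rev := by rintro rfl; simp at hr
    apply stepA
    · simpa using hij
    · rw [Perm.mul_apply, Perm.mul_apply, swap_apply_of_ne_of_ne hr'.symm hj,
        swap_apply_of_ne_of_ne hi (Ne.symm hr), hu, hu]
      simpa using h

theorem B_to_A {n : ℕ} {u v : P n} (hu : IsSignedPerm u) (h : bruhatLE (simplesB n) u v) :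
    IsSignedPerm v ∧ bruhatLE (simplesA n) u v := by
  induction h with
  | refl => exact ⟨hu, Relation.ReflTransGen.refl⟩
  | tail _ hst ih =>
    obtain ⟨hb, hub⟩ := ih
    obtain ⟨t, ht, rfl, hlen⟩ := hst
    obtain ⟨i, j, hij, rfl⟩ := reflB_form ht
    refine ⟨signed_mul hb (T_signed hij.ne), hub.trans (stepB_A i j hij _ hb ?_)⟩
    by_contra hc
    have := lenB_lt i j hij _ hb (lt_of_le_of_ne (not_lt.mp hc)
      (fun e => hij.ne' (Equiv.injective _ e)))
    omega

/-! ### Rank function -/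

def R {n : ℕ} (u : P n) (x y : ℕ) : ℤ := ∑ i, if i.val < x ∧ y ≤ (u i).val then 1 else 0

theorem R_swap {n : ℕ} (u : P n) (i j : Fin (2*n)) (hij : i < j) (h : u i < u j) (x y : ℕ) :
    R (u * swap i j) x y = R u x y +
      if i.val < x ∧ x ≤ j.val ∧ (u i).val < y ∧ y ≤ (u j).val then 1 else 0 := by
  have e1 : R (u * swap i j) x y = ∑ k, if (swap i j k).val < x ∧ y ≤ (u k).val then (1:ℤ) else 0 := by
    unfold R
    rw [← Equiv.sum_comp (swap i j)]
    simp
  have e2 : (if i.val < x ∧ x ≤ j.val ∧ (u i).val < y ∧ y ≤ (u j).val then (1:ℤ) else 0) =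
      ∑ k, ((if k = i then (if j.val < x ∧ y ≤ (u i).val then (1:ℤ) else 0) -
          (if i.val < x ∧ y ≤ (u i).val then 1 else 0) else 0) +
        (if k = j then (if i.val < x ∧ y ≤ (u j).val then (1:ℤ) else 0) -
          (if j.val < x ∧ y ≤ (u j).val then 1 else 0) else 0)) := by
    rw [Finset.sum_add_distrib]
    simp only [Finset.sum_ite_eq', Finset.mem_univ, if_true]
    rw [Fin.lt_def] at *
    split_ifs <;> omega
  rw [e1, e2]
  unfold R
  rw [← Finset.sum_add_distrib]
  refine Finset.sum_congr rfl fun k _ => ?_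
  by_cases h1 : k = i
  · subst h1; simp [hij.ne]
  · by_cases h2 : k = j
    · subst h2; simp [hij.ne']
    · simp [h1, h2, swap_apply_of_ne_of_ne h1 h2]

theorem A_to_R {n : ℕ} {u v : P n} (h : bruhatLE (simplesA n) u v) (x y : ℕ) : R u x y ≤ R v x y := by
  induction h with
  | refl => exact le_rfl
  | @tail b c _ hst ih =>
    obtain ⟨t, ht, rfl, hlen⟩ := hst
    obtain ⟨i, j, hij, rfl⟩ := reflA_form ht
    have : b i < b j := by
      by_contra hc
      have := lenA_lt i j hij b (lt_of_le_of_ne (not_lt.mp hc)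
        (fun e => hij.ne' (Equiv.injective _ e)))
      omega
    rw [R_swap b i j hij this]
    split_ifs <;> omega

theorem R_symm {n : ℕ} {u : P n} (hu : IsSignedPerm u) {x y : ℕ} (hx : x ≤ 2*n) (hy : y ≤ 2*n) :
    R u x y = R u (2*n - x) (2*n - y) +
      ((∑ i : Fin (2*n), if i.val < x then 1 else 0) - ∑ i : Fin (2*n), if i.val < y then 1 else 0) := by
  have e1 : R u (2*n-x) (2*n-y) = ∑ i, if x ≤ i.val ∧ (u i).val < y then (1:ℤ) else 0 := by
    unfold R
    rw [← Equiv.sum_comp Fin.revPerm]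
    refine Finset.sum_congr rfl fun i _ => ?_
    simp only [Fin.revPerm_apply, hu i, Fin.val_rev]
    congr 1
    apply propext
    omega
  have e2 : (∑ i : Fin (2*n), if i.val < y then (1:ℤ) else 0) =
      ∑ i, if (u i).val < y then 1 else 0 := by
    rw [Equiv.sum_comp u (fun i => if i.val < y then (1:ℤ) else 0)]
  rw [e1, e2]
  unfold R
  rw [← Finset.sum_sub_distrib, ← Finset.sum_add_distrib]
  refine Finset.sum_congr rfl fun i _ => ?_
  split_ifs <;> omega

theorem D_symm {n : ℕ} {u v : P n} (hu : IsSignedPerm u) (hv : IsSignedPerm v) {x y : ℕ}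
    (hx : x ≤ 2*n) (hy : y ≤ 2*n) :
    R v x y - R u x y = R v (2*n-x) (2*n-y) - R u (2*n-x) (2*n-y) := by
  rw [R_symm hu hx hy, R_symm hv hx hy]; ring

theorem D_strict {n : ℕ} {u v : P n} (h : ∀ x y, R u x y ≤ R v x y) (a : Fin (2*n)) (x y : ℕ)
    (hagree : ∀ i < a, u i = v i) (hax : a.val < x) (hy1 : (u a).val < y) (hy2 : y ≤ (v a).val)
    (hgap : ∀ i, a < i → i.val < x → (u a).val < (u i).val → (v a).val < (u i).val) :
    R u x y + 1 ≤ R v x y := by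
  have h1 := h x ((v a).val + 1)
  have : R u x y - R u x ((v a).val+1) + (∑ i, if i = a then 1 else 0) ≤
      R v x y - R v x ((v a).val + 1) := by
    unfold R
    rw [← Finset.sum_sub_distrib, ← Finset.sum_sub_distrib, ← Finset.sum_add_distrib]
    refine Finset.sum_le_sum fun i _ => ?_
    rcases lt_trichotomy i a with hi | hi | hi
    · rw [hagree i hi, if_neg hi.ne]; simp
    · subst hi
      rw [if_pos rfl]
      split_ifs <;> omega
    · rw [if_neg hi.ne']
      have := hgap i hi
      split_ifs <;> omega
  simp only [Finset.sum_ite_eq', Finset.mem_univ, if_true] at this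
  omega

theorem R_agree {n : ℕ} {u v : P n} (a : Fin (2*n)) (x y : ℕ)
    (hagree : ∀ i < a, u i = v i) (hx : x ≤ a.val) : R u x y = R v x y := by
  unfold R
  refine Finset.sum_congr rfl fun i _ => ?_
  by_cases hi : i < a
  · rw [hagree i hi]
  · rw [Fin.lt_def] at hi
    rw [if_neg (by omega), if_neg (by omega)]

theorem key {n : ℕ} {u v : P n} (hu : IsSignedPerm u) (hv : IsSignedPerm v)
    (h : ∀ x y, R u x y ≤ R v x y) (hne : u ≠ v) :
    ∃ i j, i < j ∧ u i < u j ∧ (∀ x y, R (u * T i j) x y ≤ R v x y) := by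
  obtain ⟨a, ha, hamin⟩ : ∃ a, u a ≠ v a ∧ ∀ i < a, u i = v i := by
    have hex : ∃ a, u a ≠ v a := by
      by_contra! hc
      exact hne (Equiv.ext hc)
    obtain ⟨a, ha, hm⟩ := WellFounded.has_min (wellFounded_lt (α := Fin (2*n))) {a | u a ≠ v a} hex
    refine ⟨a, ha, fun i hi => ?_⟩
    by_contra hc
    exact hm i hc hi
  have hav : (u a).val < (v a).val := by
    by_contra hc
    have h1 : (v a).val < (u a).val := by
      have : (u a).val ≠ (v a).val := fun e => ha (Fin.ext e)
      omega
    have h2 := h (a.val+1) (u a).val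
    have : R u (a.val+1) (u a).val = R v (a.val+1) (u a).val + ∑ i, if i = a then 1 else 0 := by
      unfold R
      rw [← Finset.sum_add_distrib]
      refine Finset.sum_congr rfl fun i _ => ?_
      rcases lt_trichotomy i a with hi | hi | hi
      · rw [hamin i hi, if_neg hi.ne]; simp
      · subst hi
        rw [if_pos rfl]
        split_ifs <;> omega
      · rw [if_neg hi.ne']
        rw [Fin.lt_def] at hi
        split_ifs <;> omega
    simp only [Finset.sum_ite_eq', Finset.mem_univ, if_true] at this
    omega
  obtain ⟨b, ⟨hab, hb1, hb2⟩, hbmin⟩ : ∃ b, (a < b ∧ (u a).val < (u b).val ∧ (u b).val ≤ (v a).val) ∧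
      ∀ i, a < i → i < b → (u a).val < (u i).val → (v a).val < (u i).val := by
    have hex : ∃ b, a < b ∧ (u a).val < (u b).val ∧ (u b).val ≤ (v a).val := by
      refine ⟨u⁻¹ (v a), ?_, by simpa using hav, by simp⟩
      by_contra hc
      rcases lt_or_eq_of_le (not_lt.mp hc) with h1 | h1
      · have h2 := hamin _ h1
        rw [show u (u⁻¹ (v a)) = v a by simp] at h2
        exact h1.ne (v.injective h2).symm
      · apply ha
        conv_lhs => rw [← h1]
        simp
    obtain ⟨b, hb, hm⟩ := WellFounded.has_min (wellFounded_lt (α := Fin (2*n)))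
      {b | a < b ∧ (u a).val < (u b).val ∧ (u b).val ≤ (v a).val} hex
    refine ⟨b, hb, fun i h1 h2 h3 => ?_⟩
    by_contra hc
    exact hm i ⟨h1, h3, not_lt.mp hc⟩ h2
  have hs1 : ∀ x y, a.val < x → x ≤ b.val → (u a).val < y → y ≤ (v a).val →
      R u x y + 1 ≤ R v x y := fun x y h1 h2 h3 h4 =>
    D_strict h a x y hamin h1 h3 h4 fun i hi hix => hbmin i hi (by rw [Fin.lt_def]; omega)
  have hs2 : ∀ x y, x ≤ 2*n → y ≤ 2*n → a.val < 2*n-x → 2*n-x ≤ b.val → (u a).val < 2*n-y →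
      2*n-y ≤ (v a).val → R u x y + 1 ≤ R v x y := fun x y hx hy h1 h2 h3 h4 => by
    have := hs1 _ _ h1 h2 h3 h4
    have := D_symm hu hv hx hy
    omega
  have hvlt := (v a).isLt
  have hblt := b.isLt
  have hbr : b.val ≤ 2*n - (a.val+1) := by
    by_contra hc
    have h1 := hs1 b.val (v a).val hab le_rfl hav le_rfl
    have h2 := D_symm hu hv (x := b.val) (y := (v a).val) (by omega) (by omega)
    have h3 := R_agree (u := u) (v := v) a (2*n-b.val) (2*n-(v a).val) hamin (by omega)
    omega
  have hab' := hab
  rw [Fin.lt_def] at hab'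
  have hra := congrArg Fin.val (hu a)
  have hrb := congrArg Fin.val (hu b)
  simp only [Fin.val_rev] at hra hrb
  by_cases hbe : b = a.rev
  · refine ⟨a, b, hab, hb1, fun x y => ?_⟩
    unfold T
    rw [if_pos hbe, R_swap u a b hab hb1]
    have := h x y
    have := hs1 x y
    split_ifs <;> omega
  by_cases hov : 2*n - b.val ≤ b.val ∧ (u a).val < 2*n-1-(u a).val ∧ 2*n-(u b).val ≤ (u b).val
  · -- the two boxes overlap: use the swap of `a` and `-a`
    have hbv : b.val ≠ a.rev.val := fun e => hbe (Fin.ext e)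
    rw [Fin.val_rev] at hbv
    have h1 := hbmin b.rev (by rw [Fin.lt_def, Fin.val_rev]; omega)
      (by rw [Fin.lt_def, Fin.val_rev]; omega)
    have h2 : (u b.rev).val ≠ (u a).val := fun e => by
      have := u.injective (Fin.ext e)
      rw [Fin.ext_iff, Fin.val_rev] at this
      omega
    have hlt : a < a.rev := by rw [Fin.lt_def, Fin.val_rev]; omega
    have hult : u a < u a.rev := by rw [Fin.lt_def, hra]; omega
    refine ⟨a, a.rev, hlt, hult, fun x y => ?_⟩
    unfold T
    rw [if_pos rfl, R_swap u a a.rev hlt hult, hra, Fin.val_rev]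
    have := h x y
    have := hs1 x y
    have := hs2 x y
    split_ifs <;> omega
  · refine ⟨a, b, hab, hb1, fun x y => ?_⟩
    have hbv : b.val ≠ a.rev.val := fun e => hbe (Fin.ext e)
    rw [Fin.val_rev] at hbv
    have hr' : b.rev ≠ a := by rw [Ne, Fin.ext_iff, Fin.val_rev]; omega
    unfold T
    rw [if_neg hbe, ← mul_assoc, swap_comm a.rev]
    have e1 : (u * swap a b) b.rev = u b.rev := by
      rw [Perm.mul_apply, swap_apply_of_ne_of_ne hr' (rev_ne b)]
    have e2 : (u * swap a b) a.rev = u a.rev := by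
      rw [Perm.mul_apply, swap_apply_of_ne_of_ne (rev_ne a) (Ne.symm hbe)]
    rw [R_swap (u * swap a b) b.rev a.rev (by simpa using hab)
      (by rw [e1, e2, Fin.lt_def, hra, hrb]; omega), R_swap u a b hab hb1, e1, e2, hra, hrb,
      Fin.val_rev, Fin.val_rev]
    have := h x y
    have := hs1 x y
    have := hs2 x y
    split_ifs <;> omega

def tot {n : ℕ} (u : P n) : ℤ := ∑ x ∈ Finset.range (2*n+1), ∑ y ∈ Finset.range (2*n+1), R u x y

theorem R_strict_T {n : ℕ} {u : P n} (hu : IsSignedPerm u) {i j : Fin (2*n)} (hij : i < j)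
    (h : u i < u j) : (∀ x y, R u x y ≤ R (u * T i j) x y) ∧
      R u j.val (u j).val < R (u * T i j) j.val (u j).val := by
  have hA : ∀ x y, R u x y ≤ R (u * swap i j) x y := fun x y => by
    rw [R_swap u i j hij h]; split_ifs <;> omega
  have hB : R u j.val (u j).val < R (u * swap i j) j.val (u j).val := by
    rw [R_swap u i j hij h, if_pos ⟨hij, le_rfl, h, le_rfl⟩]; omega
  unfold T
  split_ifs with hr
  · exact ⟨hA, hB⟩
  · have hr' : j.rev ≠ i := by rintro rfl; simp at hr
    have e1 : (u * swap i j) j.rev = u j.rev := by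
      rw [Perm.mul_apply, swap_apply_of_ne_of_ne hr' (rev_ne j)]
    have e2 : (u * swap i j) i.rev = u i.rev := by
      rw [Perm.mul_apply, swap_apply_of_ne_of_ne (rev_ne i) (Ne.symm hr)]
    have hC : ∀ x y, R (u * swap i j) x y ≤ R (u * (swap i j * swap i.rev j.rev)) x y := fun x y => by
      rw [← mul_assoc, swap_comm i.rev, R_swap (u * swap i j) j.rev i.rev (by simpa using hij)
        (by rw [e1, e2, hu, hu]; simpa using h)]
      split_ifs <;> omega
    exact ⟨fun x y => (hA x y).trans (hC x y), hB.trans_le (hC _ _)⟩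

theorem R_to_B {n : ℕ} {v : P n} (hv : IsSignedPerm v) (k : ℕ) : ∀ u : P n, IsSignedPerm u →
    (∀ x y, R u x y ≤ R v x y) → tot v - tot u ≤ k → bruhatLE (simplesB n) u v := by
  induction k with
  | zero =>
    intro u hu h hk
    by_cases hne : u = v
    · rw [hne]; exact Relation.ReflTransGen.refl
    exfalso
    obtain ⟨i, j, hij, hlt, hR⟩ := key hu hv h hne
    obtain ⟨h1, h2⟩ := R_strict_T hu hij hlt
    have : tot u < tot v := by
      refine Finset.sum_lt_sum (fun x _ => Finset.sum_le_sum fun y _ => h x y) ⟨j.val, by simp, ?_⟩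
      refine Finset.sum_lt_sum (fun y _ => h _ y) ⟨(u j).val, by simp, ?_⟩
      exact h2.trans_le (hR _ _)
    simp at hk
    omega
  | succ k ih =>
    intro u hu h hk
    by_cases hne : u = v
    · rw [hne]; exact Relation.ReflTransGen.refl
    obtain ⟨i, j, hij, hlt, hR⟩ := key hu hv h hne
    obtain ⟨h1, h2⟩ := R_strict_T hu hij hlt
    have : tot u < tot (u * T i j) := by
      refine Finset.sum_lt_sum (fun x _ => Finset.sum_le_sum fun y _ => h1 x y) ⟨j.val, by simp, ?_⟩
      exact Finset.sum_lt_sum (fun y _ => h1 _ y) ⟨(u j).val, by simp, h2⟩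
    refine Relation.ReflTransGen.trans (stepB i j hij u hu hlt)
      (ih _ (signed_mul hu (T_signed hij.ne)) hR ?_)
    push_cast at hk
    omega

end SPB

/-- The signed permutations (`π(-i) = -π(i)`) form a subgroup of `S_{2n}` (so the map
sending a signed permutation to itself is an embedding of the type `B_n` Weyl group into
`S_{2n}`), and the Bruhat order of type `B_n` agrees with the restriction of the Bruhat
order of `S_{2n}` to the signed permutations. -/
theorem signed_permutations_bruhat_embedding (n : ℕ) :
    IsSignedPerm (1 : Equiv.Perm (Fin (2 * n))) ∧
    (∀ u v : Equiv.Perm (Fin (2 * n)), IsSignedPerm u → IsSignedPerm v →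
      IsSignedPerm (u * v)) ∧
    (∀ u : Equiv.Perm (Fin (2 * n)), IsSignedPerm u → IsSignedPerm u⁻¹) ∧
    (∀ u v : Equiv.Perm (Fin (2 * n)), IsSignedPerm u → IsSignedPerm v →
      (bruhatLE (simplesB n) u v ↔ bruhatLE (simplesA n) u v)) := by
  refine ⟨SPB.signed_one, fun u v => SPB.signed_mul, fun u => SPB.signed_inv, fun u v hu hv => ?_⟩
  refine ⟨fun h => (SPB.B_to_A hu h).2, fun h => ?_⟩
  exact SPB.R_to_B hv (SPB.tot v - SPB.tot u).toNat u hu (fun x y => SPB.A_to_R h x y)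
    (Int.self_le_toNat _)
end

section
/- Let t_{n,k,j} count type B_n permutation tableaux with k unrestricted rows and exactly j +'s on the diagonal, and let T_n(x,y) = Σ_{k,j} t_{n,k+1,j} x^k y^j. Then T_n(x,y) = (y+1)^n (x+1)(x+2)···(x+n-1). -/
attribute [local instance] Classical.propDecidable

/-- A shape (order ideal) inside the type `B_n` staircase `(n, n-1, …, 1)`. -/
def IsShapeB (n : ℕ) (μ : ℕ → ℕ) : Prop :=
  (∀ i, i < n → μ i ≤ n - i) ∧ (∀ i, n ≤ i → μ i = 0) ∧
  ∀ i, i + 1 < n → min (μ i) (n - (i + 1)) ≤ μ (i + 1)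

/-- The type `(B_n, n)` Le-conditions (`true` = `+`). -/
def LeCondB (n : ℕ) (μ : ℕ → ℕ) (D : ℕ → ℕ → Bool) : Prop :=
  (∀ i j, j < μ i → D i j = false →
    (∃ i', i < i' ∧ j < μ i' ∧ D i' j = true) →
    ∀ j', j' < j → D i j' = false) ∧
  (∀ i, i < n → μ i = n - i → D i (n - i - 1) = false →
    ∀ j', j' < n - i - 1 → D i j' = false)

/-- A type `B_n` permutation tableau: a Le-diagram with no all-zero column. -/
def IsPermTabB (n : ℕ) (μ : ℕ → ℕ) (D : ℕ → ℕ → Bool) : Prop :=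
  IsShapeB n μ ∧ (∀ i j, ¬ j < μ i → D i j = false) ∧ LeCondB n μ D ∧
  ∀ j, (∃ i, j < μ i) → ∃ i, j < μ i ∧ D i j = true

/-- Row `i` is restricted if it contains a restricted `0`: a `0` on the diagonal or with a
`+` below it in its column. -/
def RestrictedRow (n : ℕ) (μ : ℕ → ℕ) (D : ℕ → ℕ → Bool) (i : ℕ) : Prop :=
  ∃ j, j < μ i ∧ D i j = false ∧
    (i + j + 1 = n ∨ ∃ i', i < i' ∧ j < μ i' ∧ D i' j = true)

/-- The number of unrestricted rows (among the `n` rows of the staircase). -/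
noncomputable def unresCount (n : ℕ) (μ : ℕ → ℕ) (D : ℕ → ℕ → Bool) : ℕ :=
  ((Finset.range n).filter fun i => ¬ RestrictedRow n μ D i).card

/-- The number of `+`'s on the diagonal. -/
noncomputable def diagCount (n : ℕ) (μ : ℕ → ℕ) (D : ℕ → ℕ → Bool) : ℕ :=
  ((Finset.range n).filter fun i => μ i = n - i ∧ D i (n - i - 1) = true).card

/-- `t_{n,k,j}`: the number of type `B_n` permutation tableaux with `k` unrestricted rows
and exactly `j` `+`'s on the diagonal. -/
noncomputable def tB (n k j : ℕ) : ℕ :=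
  Nat.card {x : (ℕ → ℕ) × (ℕ → ℕ → Bool) //
    IsPermTabB n x.1 x.2 ∧ unresCount n x.1 x.2 = k ∧ diagCount n x.1 x.2 = j}

open MvPolynomial in
/-- `T_n(x,y) = Σ_{k,j} t_{n,k+1,j} x^k y^j`, with `x = X 0` and `y = X 1`. -/
noncomputable def TB (n : ℕ) : MvPolynomial (Fin 2) ℤ :=
  ∑ k ∈ Finset.range (n + 1), ∑ j ∈ Finset.range (n + 1),
    (tB n (k + 1) j : MvPolynomial (Fin 2) ℤ) * X 0 ^ k * X 1 ^ j

/-- Pairs (shape, filling). -/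
abbrev Tab := (ℕ → ℕ) × (ℕ → ℕ → Bool)

/-- Add an empty row on top. -/
def addRow (T : Tab) : Tab :=
  (fun i => match i with | 0 => 0 | i + 1 => T.1 i,
   fun i j => match i with | 0 => false | i + 1 => T.2 i j)

/-- Remove the top row. -/
def delRow (T : Tab) : Tab := (fun i => T.1 (i + 1), fun i j => T.2 (i + 1) j)

/-- Add a full leftmost column whose `+`'s are in the rows of `S`. -/
noncomputable def addCol (n : ℕ) (T : Tab) (S : Finset ℕ) : Tab :=
  (fun i => if i ≤ n then T.1 i + 1 else 0,
   fun i j => match j with | 0 => decide (i ∈ S) | j + 1 => T.2 i j)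

/-- Remove the leftmost column. -/
def delCol (T : Tab) : Tab := (fun i => T.1 i - 1, fun i j => T.2 i (j + 1))

/-- Rows of the leftmost column with a `+`. -/
noncomputable def colSet (n : ℕ) (T : Tab) : Finset ℕ :=
  (Finset.range (n + 1)).filter fun i => T.2 i 0 = true

/-- Unrestricted rows, including the empty row `n`. -/
noncomputable def unresPlus (n : ℕ) (T : Tab) : Finset ℕ :=
  (Finset.range (n + 1)).filter fun i => ¬ RestrictedRow n T.1 T.2 i

theorem delRow_addRow (T : Tab) : delRow (addRow T) = T := rfl

theorem isPermTab_addRow {n : ℕ} {T : Tab} (h : IsPermTabB n T.1 T.2) :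
    IsPermTabB (n + 1) (addRow T).1 (addRow T).2 := by
  obtain ⟨⟨h1, h2, h3⟩, h4, ⟨h5, h6⟩, h7⟩ := h
  refine ⟨⟨?_, ?_, ?_⟩, ?_, ⟨?_, ?_⟩, ?_⟩
  · rintro (_ | i) hi
    · simp [addRow]
    · have := h1 i (by omega)
      simp only [addRow]; omega
  · rintro (_ | i) hi
    · rfl
    · exact h2 i (by omega)
  · rintro (_ | i) hi
    · simp [addRow]
    · have := h3 i (by omega)
      simp only [addRow]
      rwa [show n + 1 - (i + 1 + 1) = n - (i + 1) by omega]
  · rintro (_ | i) j hj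
    · rfl
    · exact h4 i j hj
  · rintro (_ | i) j hj hD ⟨i', hi, hj', hD'⟩ j' hjj
    · rfl
    · obtain _ | i' := i'
      · omega
      · exact h5 i j hj hD ⟨i', by omega, hj', hD'⟩ j' hjj
  · rintro (_ | i) hi hμ hD j' hj'
    · rfl
    · rw [show n + 1 - (i + 1) - 1 = n - i - 1 by omega] at hD hj'
      exact h6 i (by omega) (by simp only [addRow] at hμ; omega) hD j' hj'
  · rintro j ⟨i, hi⟩
    obtain _ | i := i
    · simp [addRow] at hi
    · obtain ⟨k, hk⟩ := h7 j ⟨i, hi⟩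
      exact ⟨k + 1, hk⟩

theorem isPermTab_delRow {n : ℕ} {T : Tab} (h : IsPermTabB (n + 1) T.1 T.2) (h0 : T.1 0 = 0) :
    IsPermTabB n (delRow T).1 (delRow T).2 := by
  obtain ⟨⟨h1, h2, h3⟩, h4, ⟨h5, h6⟩, h7⟩ := h
  refine ⟨⟨?_, ?_, ?_⟩, ?_, ⟨?_, ?_⟩, ?_⟩
  · intro i hi
    have := h1 (i + 1) (by omega)
    simp only [delRow]; omega
  · intro i hi
    exact h2 (i + 1) (by omega)
  · intro i hi
    have := h3 (i + 1) (by omega)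
    simp only [delRow]
    rwa [show n + 1 - (i + 1 + 1) = n - (i + 1) by omega] at this
  · intro i j hj
    exact h4 (i + 1) j hj
  · rintro i j hj hD ⟨i', hi, hj', hD'⟩ j' hjj
    exact h5 (i + 1) j hj hD ⟨i' + 1, by omega, hj', hD'⟩ j' hjj
  · intro i hi hμ hD j' hj'
    have := h6 (i + 1) (by omega) (by simp only [delRow] at hμ; omega)
    rw [show n + 1 - (i + 1) - 1 = n - i - 1 by omega] at this
    exact this hD j' hj'
  · rintro j ⟨i, hi⟩
    obtain ⟨k, hk⟩ := h7 j ⟨i + 1, hi⟩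
    obtain _ | k := k
    · omega
    · exact ⟨k, hk⟩

theorem addRow_delRow {n : ℕ} {T : Tab} (h : IsPermTabB (n + 1) T.1 T.2) (h0 : T.1 0 = 0) :
    addRow (delRow T) = T := by
  refine Prod.ext ?_ ?_
  · funext i
    obtain _ | i := i
    · exact h0.symm
    · rfl
  · funext i j
    obtain _ | i := i
    · exact (h.2.1 0 j (by omega)).symm
    · rfl

theorem restricted_addRow (n : ℕ) (T : Tab) (i : ℕ) :
    RestrictedRow (n + 1) (addRow T).1 (addRow T).2 (i + 1) ↔ RestrictedRow n T.1 T.2 i := by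
  constructor
  · rintro ⟨j, hj, hD, h⟩
    refine ⟨j, hj, hD, ?_⟩
    rcases h with h | ⟨i', hi, h⟩
    · left; omega
    · obtain _ | i' := i'
      · omega
      · exact Or.inr ⟨i', by omega, h⟩
  · rintro ⟨j, hj, hD, h⟩
    refine ⟨j, hj, hD, ?_⟩
    rcases h with h | ⟨i', hi, h⟩
    · left; omega
    · exact Or.inr ⟨i' + 1, by omega, h⟩

theorem restricted_addRow_zero (n : ℕ) (T : Tab) :
    ¬ RestrictedRow (n + 1) (addRow T).1 (addRow T).2 0 := by
  rintro ⟨j, hj, _⟩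
  simp [addRow] at hj

theorem unres_addRow (n : ℕ) (T : Tab) :
    unresCount (n + 1) (addRow T).1 (addRow T).2 = unresCount n T.1 T.2 + 1 := by
  unfold unresCount
  rw [Finset.range_eq_Ico, ← Finset.insert_Ico_add_one_left_eq_Ico (by omega),
    Finset.filter_insert, if_pos (restricted_addRow_zero n T), Finset.card_insert_of_notMem (by simp)]
  congr 1
  symm
  apply Finset.card_bij (fun i _ => i + 1)
  · intro i hi
    simp only [Finset.mem_filter, Finset.mem_range, Finset.mem_Ico] at hi ⊢
    exact ⟨by omega, by rw [restricted_addRow]; exact hi.2⟩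
  · intro a _ b _ hab; omega
  · intro i hi
    simp only [Finset.mem_filter, Finset.mem_range, Finset.mem_Ico] at hi
    obtain _ | i := i
    · omega
    · refine ⟨i, ?_, rfl⟩
      simp only [Finset.mem_filter, Finset.mem_range]
      exact ⟨by omega, by rw [← restricted_addRow]; exact hi.2⟩

theorem diag_addRow (n : ℕ) (T : Tab) :
    diagCount (n + 1) (addRow T).1 (addRow T).2 = diagCount n T.1 T.2 := by
  unfold diagCount
  symm
  apply Finset.card_bij (fun i _ => i + 1)
  · intro i hi
    simp only [Finset.mem_filter, Finset.mem_range] at hi ⊢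
    rw [show n + 1 - (i + 1) = n - i by omega]
    exact ⟨by omega, hi.2⟩
  · intro a _ b _ hab; omega
  · intro i hi
    simp only [Finset.mem_filter, Finset.mem_range] at hi
    obtain _ | i := i
    · simp [addRow] at hi
    · refine ⟨i, ?_, rfl⟩
      simp only [Finset.mem_filter, Finset.mem_range]
      rw [show n + 1 - (i + 1) = n - i by omega] at hi
      exact ⟨by omega, hi.2⟩

theorem isPermTab_addCol {n : ℕ} {T : Tab} (h : IsPermTabB n T.1 T.2) {S : Finset ℕ}
    (hS : S ⊆ unresPlus n T) (hne : S.Nonempty) :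
    IsPermTabB (n + 1) (addCol n T S).1 (addCol n T S).2 := by
  obtain ⟨⟨h1, h2, h3⟩, h4, ⟨h5, h6⟩, h7⟩ := h
  have hSn : ∀ i ∈ S, i ≤ n ∧ ¬ RestrictedRow n T.1 T.2 i := by
    intro i hi
    have := hS hi
    simp only [unresPlus, Finset.mem_filter, Finset.mem_range] at this
    exact ⟨by omega, this.2⟩
  have hμ : ∀ i j, j + 1 < (addCol n T S).1 i ↔ j < T.1 i := by
    intro i j
    simp only [addCol]
    split_ifs with hi
    · omega
    · rw [h2 i (by omega)]; omega
  refine ⟨⟨?_, ?_, ?_⟩, ?_, ⟨?_, ?_⟩, ?_⟩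
  · intro i hi
    simp only [addCol]
    rw [if_pos (by omega)]
    by_cases hn : i < n
    · have := h1 i hn; omega
    · rw [h2 i (by omega)]; omega
  · intro i hi
    simp only [addCol]
    rw [if_neg (by omega)]
  · intro i hi
    simp only [addCol]
    rw [if_pos (by omega), if_pos (by omega)]
    by_cases hn : i + 1 < n
    · have := h3 i hn; omega
    · omega
  · rintro i (_ | j) hj
    · by_contra hc
      have : i ∈ S := by simpa [addCol] using hc
      apply hj
      simp only [addCol]
      rw [if_pos (hSn i this).1]; omega
    · rw [hμ] at hj
      exact h4 i j hj
  · rintro i (_ | j) hj hD ⟨i', hi, hj', hD'⟩ (_ | j') hjj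
    · omega
    · omega
    · rw [hμ] at hj hj'
      by_contra hc
      have : i ∈ S := by simpa [addCol] using hc
      exact (hSn i this).2 ⟨j, hj, hD, Or.inr ⟨i', hi, hj', hD'⟩⟩
    · rw [hμ] at hj hj'
      exact h5 i j hj hD ⟨i', hi, hj', hD'⟩ j' (by omega)
  · intro i hi hm hD j' hj'
    have hin : i < n := by omega
    rw [show n + 1 - i - 1 = (n - i - 1) + 1 by omega] at hD
    have hm' : T.1 i = n - i := by
      simp only [addCol] at hm
      rw [if_pos (by omega)] at hm; omega
    obtain _ | j' := j'
    · by_contra hc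
      have : i ∈ S := by simpa [addCol] using hc
      exact (hSn i this).2 ⟨n - i - 1, by omega, hD, Or.inl (by omega)⟩
    · exact h6 i hin hm' hD j' (by omega)
  · rintro (_ | j) ⟨i, hi⟩
    · obtain ⟨s, hs⟩ := hne
      refine ⟨s, ?_, ?_⟩
      · simp only [addCol]
        rw [if_pos (hSn s hs).1]; omega
      · simpa [addCol] using hs
    · rw [hμ] at hi
      obtain ⟨k, hk, hk'⟩ := h7 j ⟨i, hi⟩
      exact ⟨k, (hμ k j).2 hk, hk'⟩

theorem pos_of_shape {n : ℕ} {T : Tab} (h : IsPermTabB (n + 1) T.1 T.2) (h0 : T.1 0 ≠ 0) :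
    ∀ i, i ≤ n → 1 ≤ T.1 i := by
  intro i
  induction i with
  | zero => intro _; omega
  | succ i ih =>
    intro hi
    have := h.1.2.2 i (by omega)
    have := ih (by omega)
    omega

theorem isPermTab_delCol {n : ℕ} {T : Tab} (h : IsPermTabB (n + 1) T.1 T.2) (h0 : T.1 0 ≠ 0) :
    IsPermTabB n (delCol T).1 (delCol T).2 := by
  have hp := pos_of_shape h h0
  obtain ⟨⟨h1, h2, h3⟩, h4, ⟨h5, h6⟩, h7⟩ := h
  have hμ : ∀ i j, j < (delCol T).1 i ↔ j + 1 < T.1 i := by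
    intro i j
    simp only [delCol]
    omega
  refine ⟨⟨?_, ?_, ?_⟩, ?_, ⟨?_, ?_⟩, ?_⟩
  · intro i hi
    have := h1 i (by omega)
    simp only [delCol]; omega
  · intro i hi
    simp only [delCol]
    by_cases hn : i = n
    · have := h1 i (by omega); omega
    · have := h2 i (by omega); omega
  · intro i hi
    have := h3 i (by omega)
    simp only [delCol]; omega
  · intro i j hj
    rw [hμ] at hj
    exact h4 i (j + 1) hj
  · rintro i j hj hD ⟨i', hi, hj', hD'⟩ j' hjj
    rw [hμ] at hj hj'
    exact h5 i (j + 1) hj hD ⟨i', hi, hj', hD'⟩ (j' + 1) (by omega)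
  · intro i hi hm hD j' hj'
    have := hp i (by omega)
    simp only [delCol] at hm hD
    refine h6 i (by omega) (by omega) ?_ (j' + 1) (by omega)
    rwa [show n + 1 - i - 1 = n - i - 1 + 1 by omega]
  · rintro j ⟨i, hi⟩
    rw [hμ] at hi
    obtain ⟨k, hk, hk'⟩ := h7 (j + 1) ⟨i, hi⟩
    exact ⟨k, (hμ k j).2 hk, hk'⟩

theorem colSet_nonempty {n : ℕ} {T : Tab} (h : IsPermTabB (n + 1) T.1 T.2) (h0 : T.1 0 ≠ 0) :
    (colSet n T).Nonempty := by
  obtain ⟨i, hi, hD⟩ := h.2.2.2 0 ⟨0, by omega⟩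
  refine ⟨i, ?_⟩
  simp only [colSet, Finset.mem_filter, Finset.mem_range]
  refine ⟨?_, hD⟩
  by_contra hc
  have := h.1.2.1 i (by omega)
  omega

theorem colSet_subset {n : ℕ} {T : Tab} (h : IsPermTabB (n + 1) T.1 T.2) (h0 : T.1 0 ≠ 0) :
    colSet n T ⊆ unresPlus n (delCol T) := by
  intro i hi
  simp only [colSet, unresPlus, Finset.mem_filter, Finset.mem_range] at hi ⊢
  refine ⟨hi.1, ?_⟩
  obtain ⟨⟨h1, h2, h3⟩, h4, ⟨h5, h6⟩, h7⟩ := h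
  rintro ⟨j, hj, hD, hc⟩
  simp only [delCol] at hj hD hc
  rcases hc with hc | ⟨i', hi', hj', hD'⟩
  · have := h1 i hi.1
    have := h6 i hi.1 (by omega) (by rwa [show n + 1 - i - 1 = j + 1 by omega]) 0 (by omega)
    simp [hi.2] at this
  · have := h5 i (j + 1) (by omega) hD ⟨i', hi', by omega, hD'⟩ 0 (by omega)
    simp [hi.2] at this

theorem addCol_delCol {n : ℕ} {T : Tab} (h : IsPermTabB (n + 1) T.1 T.2) (h0 : T.1 0 ≠ 0) :
    addCol n (delCol T) (colSet n T) = T := by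
  have hp := pos_of_shape h h0
  refine Prod.ext ?_ ?_
  · funext i
    simp only [addCol, delCol]
    split_ifs with hi
    · have := hp i hi; omega
    · exact (h.1.2.1 i (by omega)).symm
  · funext i j
    obtain _ | j := j
    · simp only [addCol, colSet, Finset.mem_filter, Finset.mem_range]
      by_cases hi : i < n + 1
      · simp [hi]
      · have := h.2.1 i 0 (by rw [h.1.2.1 i (by omega)]; omega)
        simp [this]
    · rfl

theorem delCol_addCol {n : ℕ} {T : Tab} (h : IsPermTabB n T.1 T.2) (S : Finset ℕ) :
    delCol (addCol n T S) = T := by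
  refine Prod.ext ?_ ?_
  · funext i
    simp only [addCol, delCol]
    split_ifs with hi
    · omega
    · have := h.1.2.1 i (by omega); omega
  · rfl

theorem colSet_addCol {n : ℕ} {T : Tab} {S : Finset ℕ} (hS : S ⊆ unresPlus n T) :
    colSet n (addCol n T S) = S := by
  ext i
  simp only [colSet, addCol, Finset.mem_filter, Finset.mem_range, decide_eq_true_eq]
  refine ⟨fun h => h.2, fun h => ⟨?_, h⟩⟩
  have := hS h
  simp only [unresPlus, Finset.mem_filter, Finset.mem_range] at this
  exact this.1

theorem restricted_addCol {n : ℕ} {T : Tab} (h : IsPermTabB n T.1 T.2) {S : Finset ℕ}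
    (hS : S ⊆ unresPlus n T) {i : ℕ} (hi : i ≤ n) :
    RestrictedRow (n + 1) (addCol n T S).1 (addCol n T S).2 i ↔
      RestrictedRow n T.1 T.2 i ∨ (i ∉ S ∧ (i = n ∨ ∃ s ∈ S, i < s)) := by
  have hμ : ∀ i j, j + 1 < (addCol n T S).1 i ↔ j < T.1 i := by
    intro i j
    simp only [addCol]
    split_ifs with hi
    · omega
    · rw [h.1.2.1 i (by omega)]; omega
  have hSn : ∀ i ∈ S, 0 < (addCol n T S).1 i := by
    intro i hi
    have := hS hi
    simp only [unresPlus, Finset.mem_filter, Finset.mem_range] at this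
    simp only [addCol]
    rw [if_pos (by omega)]; omega
  constructor
  · rintro ⟨_ | j, hj, hD, hc⟩
    · right
      refine ⟨by simpa [addCol] using hD, ?_⟩
      rcases hc with hc | ⟨i', hi', hj', hD'⟩
      · left; omega
      · exact Or.inr ⟨i', by simpa [addCol] using hD', hi'⟩
    · left
      rw [hμ] at hj
      refine ⟨j, hj, hD, ?_⟩
      rcases hc with hc | ⟨i', hi', hj', hD'⟩
      · left; omega
      · exact Or.inr ⟨i', hi', (hμ _ _).1 hj', hD'⟩
  · rintro (⟨j, hj, hD, hc⟩ | ⟨hiS, hc⟩)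
    · refine ⟨j + 1, (hμ _ _).2 hj, hD, ?_⟩
      rcases hc with hc | ⟨i', hi', hj', hD'⟩
      · left; omega
      · exact Or.inr ⟨i', hi', (hμ _ _).2 hj', hD'⟩
    · refine ⟨0, ?_, by simpa [addCol] using hiS, ?_⟩
      · simp only [addCol]
        rw [if_pos hi]; omega
      · rcases hc with hc | ⟨s, hs, his⟩
        · left; omega
        · exact Or.inr ⟨s, his, hSn s hs, by simpa [addCol] using hs⟩

/-- The unrestricted rows. -/
noncomputable def unresSet (n : ℕ) (T : Tab) : Finset ℕ :=
  (Finset.range n).filter fun i => ¬ RestrictedRow n T.1 T.2 i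

theorem unresPlus_eq {n : ℕ} {T : Tab} (h : IsPermTabB n T.1 T.2) :
    unresPlus n T = insert n (unresSet n T) := by
  unfold unresPlus unresSet
  rw [Finset.range_add_one, Finset.filter_insert, if_pos]
  rintro ⟨j, hj, _⟩
  rw [h.1.2.1 n le_rfl] at hj
  omega

theorem notMem_unresSet (n : ℕ) (T : Tab) : n ∉ unresSet n T := by
  simp [unresSet]

/-- Case of a `+` in the new diagonal box. -/
theorem unres_addCol_plus {n : ℕ} {T : Tab} (h : IsPermTabB n T.1 T.2) {S : Finset ℕ}
    (hS : S ⊆ unresSet n T) :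
    unresCount (n + 1) (addCol n T (insert n S)).1 (addCol n T (insert n S)).2 = S.card + 1 := by
  have hS' : insert n S ⊆ unresPlus n T := by
    rw [unresPlus_eq h]; exact Finset.insert_subset_insert _ hS
  have hn : n ∉ S := fun hc => notMem_unresSet n T (hS hc)
  rw [← Finset.card_insert_of_notMem hn]
  unfold unresCount
  congr 1
  ext i
  simp only [Finset.mem_filter, Finset.mem_range]
  constructor
  · rintro ⟨hi, hr⟩
    rw [restricted_addCol h hS' (by omega)] at hr
    by_contra hc
    apply hr
    right
    refine ⟨hc, ?_⟩
    by_cases hin : i = n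
    · exact Or.inl hin
    · exact Or.inr ⟨n, by simp, by omega⟩
  · intro hi
    have h1 := hS' hi
    simp only [unresPlus, Finset.mem_filter, Finset.mem_range] at h1
    refine ⟨h1.1, ?_⟩
    rw [restricted_addCol h hS' (by omega)]
    tauto

/-- Case of a `0` in the new diagonal box. -/
theorem unres_addCol_zero {n : ℕ} {T : Tab} (h : IsPermTabB n T.1 T.2) {S : Finset ℕ}
    (hS : S ⊆ unresSet n T) :
    unresCount (n + 1) (addCol n T S).1 (addCol n T S).2 =
      ((unresSet n T).filter fun i => i ∈ S ∨ ∀ s ∈ S, s ≤ i).card := by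
  have hS' : S ⊆ unresPlus n T := by
    rw [unresPlus_eq h]; exact hS.trans (Finset.subset_insert _ _)
  have hn : n ∉ S := fun hc => notMem_unresSet n T (hS hc)
  unfold unresCount
  congr 1
  ext i
  simp only [Finset.mem_filter, Finset.mem_range, unresSet]
  constructor
  · rintro ⟨hi, hr⟩
    rw [restricted_addCol h hS' (by omega)] at hr
    push Not at hr
    by_cases hiS : i ∈ S
    · have := hS hiS
      simp only [Finset.mem_filter, Finset.mem_range, unresSet] at this
      exact ⟨this, Or.inl hiS⟩
    · have := hr.2 hiS
      exact ⟨⟨by omega, hr.1⟩, Or.inr this.2⟩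
  · rintro ⟨⟨hi, hr⟩, hc⟩
    refine ⟨by omega, ?_⟩
    rw [restricted_addCol h hS' (by omega)]
    push Not
    refine ⟨hr, fun hiS => ⟨by omega, ?_⟩⟩
    tauto

theorem diag_addCol (n : ℕ) (T : Tab) (S : Finset ℕ) (h : T.1 n = 0) :
    diagCount (n + 1) (addCol n T S).1 (addCol n T S).2 =
      diagCount n T.1 T.2 + if n ∈ S then 1 else 0 := by
  unfold diagCount
  rw [Finset.range_add_one, Finset.filter_insert]
  have key : ((Finset.range n).filter fun i => (addCol n T S).1 i = n + 1 - i ∧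
      (addCol n T S).2 i (n + 1 - i - 1) = true) =
      (Finset.range n).filter fun i => T.1 i = n - i ∧ T.2 i (n - i - 1) = true := by
    apply Finset.filter_congr
    intro i hi
    rw [Finset.mem_range] at hi
    rw [show n + 1 - i - 1 = (n - i - 1) + 1 by omega]
    have : (addCol n T S).1 i = n + 1 - i ↔ T.1 i = n - i := by
      simp only [addCol]
      rw [if_pos (by omega)]; omega
    rw [this]
    rfl
  rw [key]
  have h2 : ((addCol n T S).1 n = n + 1 - n ∧ (addCol n T S).2 n (n + 1 - n - 1) = true) ↔ n ∈ S := by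
    rw [show n + 1 - n - 1 = 0 by omega]
    simp [addCol, h]
  by_cases hn : n ∈ S
  · rw [if_pos (h2.2 hn), if_pos hn, Finset.card_insert_of_notMem (by simp)]
  · rw [if_neg (fun hc => hn (h2.1 hc)), if_neg hn]; rfl

theorem comb_sum {R : Type*} [CommRing R] (x : R) (U : Finset ℕ) :
    (∑ S ∈ U.powerset, if S.Nonempty then
      x ^ (U.filter fun i => i ∈ S ∨ ∀ s ∈ S, s ≤ i).card else 0)
      = x * (x + 1) ^ U.card - x ^ (U.card + 1) := by
  induction U using Finset.induction_on_min with
  | empty => rw [Finset.powerset_empty, Finset.sum_singleton, if_neg (by simp)]; simp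
  | insert a U ha ih =>
    have haU : a ∉ U := fun h => lt_irrefl _ (ha a h)
    rw [Finset.sum_powerset_insert haU, Finset.card_insert_of_notMem haU]
    have e1 : ∀ S ∈ U.powerset, (if S.Nonempty then
        x ^ ((insert a U).filter fun i => i ∈ S ∨ ∀ s ∈ S, s ≤ i).card else 0) =
        if S.Nonempty then x ^ (U.filter fun i => i ∈ S ∨ ∀ s ∈ S, s ≤ i).card else 0 := by
      intro S hS
      rw [Finset.mem_powerset] at hS
      split_ifs with hne
      · rw [Finset.filter_insert, if_neg]
        rintro (hc | hc)
        · exact haU (hS hc)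
        · obtain ⟨s, hs⟩ := hne
          have := ha s (hS hs)
          have := hc s hs
          omega
      · rfl
    have e2 : ∀ S ∈ U.powerset, (if (insert a S).Nonempty then
        x ^ ((insert a U).filter fun i => i ∈ insert a S ∨ ∀ s ∈ insert a S, s ≤ i).card else 0) =
        x * (if S.Nonempty then x ^ (U.filter fun i => i ∈ S ∨ ∀ s ∈ S, s ≤ i).card else 0)
          + if S = ∅ then x ^ (U.card + 1) else 0 := by
      intro S hS
      rw [Finset.mem_powerset] at hS
      rw [if_pos (Finset.insert_nonempty _ _), Finset.filter_insert, if_pos (by simp),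
        Finset.card_insert_of_notMem (by simp [haU])]
      have : (U.filter fun i => i ∈ insert a S ∨ ∀ s ∈ insert a S, s ≤ i) =
          U.filter fun i => i ∈ S ∨ ∀ s ∈ S, s ≤ i := by
        apply Finset.filter_congr
        intro i hi
        have := ha i hi
        simp only [Finset.mem_insert, forall_eq_or_imp]
        have h1 : i ≠ a := by omega
        have h2 : a ≤ i := by omega
        tauto
      rw [this]
      rcases Finset.eq_empty_or_nonempty S with rfl | hne
      · simp
      · rw [if_pos hne, if_neg hne.ne_empty, pow_succ]; ring
    rw [Finset.sum_congr rfl e1, Finset.sum_congr rfl e2, Finset.sum_add_distrib,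
      ← Finset.mul_sum, ih, Finset.sum_ite_eq' U.powerset ∅, if_pos (by simp)]
    ring

theorem finite_tabs (n : ℕ) : {T : Tab | IsPermTabB n T.1 T.2}.Finite := by
  induction n with
  | zero =>
    apply Set.Finite.subset (Set.finite_singleton ((fun _ => 0, fun _ _ => false) : Tab))
    intro T hT
    have h1 : ∀ i, T.1 i = 0 := fun i => hT.1.2.1 i (by omega)
    refine Prod.ext ?_ ?_
    · funext i; exact h1 i
    · funext i j; exact hT.2.1 i j (by rw [h1]; omega)
  | succ n ih =>
    apply Set.Finite.subset ((ih.image addRow).union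
      (Set.Finite.image2 (addCol n) ih (Finset.range (n + 1)).powerset.finite_toSet))
    intro T hT
    by_cases h0 : T.1 0 = 0
    · exact Or.inl ⟨delRow T, isPermTab_delRow hT h0, addRow_delRow hT h0⟩
    · refine Or.inr ⟨delCol T, isPermTab_delCol hT h0, colSet n T, ?_, addCol_delCol hT h0⟩
      rw [Finset.mem_coe, Finset.mem_powerset]
      exact Finset.filter_subset _ _

/-- The finset of tableaux. -/
noncomputable def tabs (n : ℕ) : Finset Tab := (finite_tabs n).toFinset

theorem mem_tabs {n : ℕ} {T : Tab} : T ∈ tabs n ↔ IsPermTabB n T.1 T.2 := by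
  simp [tabs]

theorem sum_tabs_succ {R : Type*} [CommRing R] (n : ℕ) (f : Tab → R) :
    ∑ T ∈ tabs (n + 1), f T = ∑ T ∈ tabs n, (f (addRow T) +
      ∑ S ∈ (unresPlus n T).powerset.filter (fun S => S.Nonempty), f (addCol n T S)) := by
  rw [← Finset.sum_filter_add_sum_filter_not (tabs (n + 1)) (fun T => T.1 0 = 0),
    Finset.sum_add_distrib]
  congr 1
  · apply Finset.sum_nbij' delRow addRow
    · intro T hT
      rw [Finset.mem_filter, mem_tabs] at hT
      exact mem_tabs.2 (isPermTab_delRow hT.1 hT.2)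
    · intro T hT
      rw [Finset.mem_filter, mem_tabs]
      exact ⟨isPermTab_addRow (mem_tabs.1 hT), rfl⟩
    · intro T hT
      rw [Finset.mem_filter, mem_tabs] at hT
      exact addRow_delRow hT.1 hT.2
    · intro T _
      exact delRow_addRow T
    · intro T hT
      rw [Finset.mem_filter, mem_tabs] at hT
      rw [addRow_delRow hT.1 hT.2]
  · rw [Finset.sum_sigma']
    apply Finset.sum_nbij' (fun T => (⟨delCol T, colSet n T⟩ : (_ : Tab) × Finset ℕ))
      (fun p => addCol n p.1 p.2)
    · intro T hT
      rw [Finset.mem_filter, mem_tabs] at hT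
      simp only [Finset.mem_sigma, Finset.mem_filter, Finset.mem_powerset, mem_tabs]
      exact ⟨isPermTab_delCol hT.1 hT.2, colSet_subset hT.1 hT.2, colSet_nonempty hT.1 hT.2⟩
    · rintro ⟨T, S⟩ hT
      simp only [Finset.mem_sigma, Finset.mem_filter, Finset.mem_powerset, mem_tabs] at hT
      rw [Finset.mem_filter, mem_tabs]
      exact ⟨isPermTab_addCol hT.1 hT.2.1 hT.2.2, by simp [addCol]⟩
    · intro T hT
      rw [Finset.mem_filter, mem_tabs] at hT
      exact addCol_delCol hT.1 hT.2
    · rintro ⟨T, S⟩ hT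
      simp only [Finset.mem_sigma, Finset.mem_filter, Finset.mem_powerset, mem_tabs] at hT
      simp only [delCol_addCol hT.1, colSet_addCol hT.2.1]
    · intro T hT
      rw [Finset.mem_filter, mem_tabs] at hT
      rw [addCol_delCol hT.1 hT.2]

/-- Weight of a tableau. -/
noncomputable def wt {R : Type*} [CommRing R] (x y : R) (n : ℕ) (T : Tab) : R :=
  x ^ unresCount n T.1 T.2 * y ^ diagCount n T.1 T.2

theorem wt_step {R : Type*} [CommRing R] (x y : R) (n : ℕ) (T : Tab) (h : IsPermTabB n T.1 T.2) :
    wt x y (n + 1) (addRow T) +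
      ∑ S ∈ (unresPlus n T).powerset.filter (fun S => S.Nonempty), wt x y (n + 1) (addCol n T S)
      = (y + 1) * x * wt (x + 1) y n T := by
  have h0 : T.1 n = 0 := h.1.2.1 n le_rfl
  have hU : unresCount n T.1 T.2 = (unresSet n T).card := rfl
  rw [Finset.sum_filter, unresPlus_eq h, Finset.sum_powerset_insert (notMem_unresSet n T)]
  have e1 : ∀ S ∈ (unresSet n T).powerset,
      (if S.Nonempty then wt x y (n + 1) (addCol n T S) else 0) =
      (if S.Nonempty then x ^ ((unresSet n T).filter fun i => i ∈ S ∨ ∀ s ∈ S, s ≤ i).card else 0)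
        * y ^ diagCount n T.1 T.2 := by
    intro S hS
    rw [Finset.mem_powerset] at hS
    have hn : n ∉ S := fun hc => notMem_unresSet n T (hS hc)
    split_ifs
    · rw [wt, unres_addCol_zero h hS, diag_addCol n T S h0, if_neg hn, add_zero]
    · simp
  have e2 : ∀ S ∈ (unresSet n T).powerset,
      (if (insert n S).Nonempty then wt x y (n + 1) (addCol n T (insert n S)) else 0) =
      x ^ S.card * (x * y ^ (diagCount n T.1 T.2 + 1)) := by
    intro S hS
    rw [Finset.mem_powerset] at hS
    rw [if_pos (Finset.insert_nonempty _ _), wt, unres_addCol_plus h hS, diag_addCol n T _ h0,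
      if_pos (by simp)]
    ring
  have e3 : ∑ S ∈ (unresSet n T).powerset, x ^ S.card = (x + 1) ^ (unresSet n T).card := by
    rw [← Finset.prod_const, Finset.prod_add]
    simp
  rw [Finset.sum_congr rfl e1, Finset.sum_congr rfl e2, ← Finset.sum_mul, ← Finset.sum_mul,
    comb_sum, e3, wt, wt, unres_addRow, diag_addRow, hU]
  ring

theorem sum_wt {R : Type*} [CommRing R] (n : ℕ) : ∀ (x y : R),
    ∑ T ∈ tabs n, wt x y n T = (y + 1) ^ n * ∏ m ∈ Finset.range n, (x + (m : R)) := by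
  induction n with
  | zero =>
    intro x y
    have : tabs 0 = {((fun _ => 0, fun _ _ => false) : Tab)} := by
      ext T
      rw [mem_tabs, Finset.mem_singleton]
      constructor
      · intro hT
        have h1 : ∀ i, T.1 i = 0 := fun i => hT.1.2.1 i (by omega)
        refine Prod.ext ?_ ?_
        · funext i; exact h1 i
        · funext i j; exact hT.2.1 i j (by rw [h1]; omega)
      · rintro rfl
        simp [IsPermTabB, IsShapeB, LeCondB]
    rw [this]
    simp [wt, unresCount, diagCount]
  | succ n ih =>
    intro x y
    rw [sum_tabs_succ, Finset.sum_congr rfl fun T hT => wt_step x y n T (mem_tabs.1 hT),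
      ← Finset.mul_sum, ih, Finset.prod_range_succ']
    have : ∀ m ∈ Finset.range n, x + ((m + 1 : ℕ) : R) = x + 1 + (m : R) := by
      intro m _; push_cast; ring
    rw [Finset.prod_congr rfl this]
    push_cast
    ring

theorem tB_eq (n k j : ℕ) : tB n k j = ((tabs n).filter fun T =>
    unresCount n T.1 T.2 = k ∧ diagCount n T.1 T.2 = j).card := by
  unfold tB
  rw [← Nat.card_eq_finsetCard]
  apply Nat.card_congr
  apply Equiv.subtypeEquivRight
  intro T
  rw [Finset.mem_filter, mem_tabs]

theorem unres_le (n : ℕ) (T : Tab) : unresCount n T.1 T.2 ≤ n :=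
  (Finset.card_filter_le _ _).trans (by simp)

theorem diag_le (n : ℕ) (T : Tab) : diagCount n T.1 T.2 ≤ n :=
  (Finset.card_filter_le _ _).trans (by simp)

theorem sum_wt_eq {R : Type*} [CommRing R] (n : ℕ) (x y : R) :
    ∑ T ∈ tabs n, wt x y n T = ∑ k ∈ Finset.range (n + 2), ∑ j ∈ Finset.range (n + 1),
      (tB n k j : R) * x ^ k * y ^ j := by
  rw [← Finset.sum_product',
    ← Finset.sum_fiberwise_of_maps_to (s := tabs n)
      (t := Finset.range (n + 2) ×ˢ Finset.range (n + 1))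
      (g := fun T => (unresCount n T.1 T.2, diagCount n T.1 T.2))]
  · apply Finset.sum_congr rfl
    rintro ⟨k, j⟩ _
    have : ∀ T ∈ (tabs n).filter (fun T => (unresCount n T.1 T.2, diagCount n T.1 T.2) = (k, j)),
        wt x y n T = x ^ k * y ^ j := by
      intro T hT
      simp only [Finset.mem_filter, Prod.mk.injEq] at hT
      rw [wt, hT.2.1, hT.2.2]
    rw [Finset.sum_congr rfl this, Finset.sum_const, tB_eq, nsmul_eq_mul, mul_assoc]
    simp only [Prod.mk.injEq]
  · intro T _
    have := unres_le n T
    have := diag_le n T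
    simp only [Finset.mem_product, Finset.mem_range]
    omega

open MvPolynomial in
/-- `T_n(x,y) = (y+1)^n (x+1)(x+2)⋯(x+n-1)`. -/
theorem TB_product_formula (n : ℕ) (hn : 1 ≤ n) :
    TB n = (X 1 + 1) ^ n *
      ∏ m ∈ Finset.Icc 1 (n - 1), (X 0 + (m : MvPolynomial (Fin 2) ℤ)) := by
  obtain ⟨m, rfl⟩ : ∃ m, n = m + 1 := ⟨n - 1, by omega⟩
  have hX : (X 0 : MvPolynomial (Fin 2) ℤ) ≠ 0 := X_ne_zero 0
  have e1 := (sum_wt_eq (m + 1) (X 0 : MvPolynomial (Fin 2) ℤ) (X 1)).symm.trans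
    (sum_wt (m + 1) (X 0) (X 1))
  have e0 := (sum_wt_eq (m + 1) (0 : MvPolynomial (Fin 2) ℤ) (X 1)).symm.trans
    (sum_wt (m + 1) 0 (X 1))
  rw [Finset.sum_range_succ', Finset.prod_range_succ'] at e1 e0
  simp only [pow_succ, pow_zero, mul_zero, zero_mul, Finset.sum_const_zero, Nat.cast_zero,
    add_zero, mul_one, zero_add] at e0
  apply mul_left_cancel₀ hX
  have hprod : ∏ i ∈ Finset.Icc 1 (m + 1 - 1), (X 0 + (i : MvPolynomial (Fin 2) ℤ)) =
      ∏ i ∈ Finset.range m, (X 0 + ((i + 1 : ℕ) : MvPolynomial (Fin 2) ℤ)) := by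
    rw [← Finset.Ico_add_one_right_eq_Icc, Finset.prod_Ico_eq_prod_range]
    apply Finset.prod_congr (by congr 1)
    intro i _
    rw [add_comm 1 i]
  have hTB : X 0 * TB (m + 1) = ∑ k ∈ Finset.range (m + 1 + 1), ∑ j ∈ Finset.range (m + 1 + 1),
      (tB (m + 1) (k + 1) j : MvPolynomial (Fin 2) ℤ) * X 0 ^ (k + 1) * X 1 ^ j := by
    unfold TB
    rw [Finset.mul_sum]
    apply Finset.sum_congr rfl
    intro k _
    rw [Finset.mul_sum]
    apply Finset.sum_congr rfl
    intro j _
    ring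
  simp only [pow_zero, mul_one] at e1
  rw [e0, add_zero] at e1
  rw [hTB, hprod, e1]
  push_cast
  ring
end

section
/- The number of fillings of a Young diagram λ ⊆ j×(n−j) rectangle by 0's and +'s avoiding the Le-pattern (no 0 with a + below it in its column and a + to its left in its row) summed over all λ in the rectangle, weighted by q^(#+'s), is equal to the number (q-count) of pairs (x,w) with x ≤ w in Bruhat order, w a minimal length coset representative in S_n/⟨s_1,...,ŝ_j,...,s_{n-1}⟩, weighted by q^{ℓ(w)−ℓ(x)}. -/
attribute [local instance] Classical.propDecidable

/-- The number of inversions of a permutation of `Fin n`; this is the Coxeter length of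
the symmetric group `S_n`. -/
noncomputable def invCount {n : ℕ} (π : Equiv.Perm (Fin n)) : ℕ :=
  (Finset.univ.filter fun p : Fin n × Fin n => p.1 < p.2 ∧ π p.2 < π p.1).card

/-- The simple generator `s_m = (m, m+1)` of `S_n` (with `1 ≤ m ≤ n-1`), `1` otherwise. -/
def genA (n m : ℕ) : Equiv.Perm (Fin n) :=
  if h : 0 < m ∧ m < n then Equiv.swap ⟨m - 1, by omega⟩ ⟨m, h.2⟩ else 1

/-- A reflection: a conjugate of a simple generator. -/
def IsReflectionA (n : ℕ) (t : Equiv.Perm (Fin n)) : Prop :=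
  ∃ w : Equiv.Perm (Fin n), ∃ m, 1 ≤ m ∧ m < n ∧ t = w * genA n m * w⁻¹

/-- Bruhat order on `S_n`: generated by right multiplication by reflections which
increase the number of inversions (= the length). -/
def bruhatA (n : ℕ) : Equiv.Perm (Fin n) → Equiv.Perm (Fin n) → Prop :=
  Relation.ReflTransGen fun u v =>
    ∃ t, IsReflectionA n t ∧ v = u * t ∧ invCount u < invCount v

/-- `w` is a minimal-length coset representative of `S_n / W_J`,
where `W_J = ⟨s_1, …, ŝ_j, …, s_{n-1}⟩`. -/
def IsMinRep (n j : ℕ) (w : Equiv.Perm (Fin n)) : Prop :=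
  ∀ g ∈ Subgroup.closure {σ : Equiv.Perm (Fin n) | ∃ m, 1 ≤ m ∧ m < n ∧ m ≠ j ∧ σ = genA n m},
    invCount w ≤ invCount (w * g)

/-- A Le-diagram contained in the `j × (n-j)` rectangle: a shape `lam` (row lengths, the
rows indexed by `Fin j` with row `0` the bottom, longest, row) together with a filling `D`
(`true` = `+`) vanishing outside the shape, such that no `0` has simultaneously a `+`
below it in its column and a `+` to its left in its row. -/
def IsLeDiagA (n j : ℕ) (lam : Fin j → Fin (n - j + 1))
    (D : Fin j × Fin (n - j) → Bool) : Prop :=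
  (∀ r r' : Fin j, r ≤ r' → (lam r' : ℕ) ≤ (lam r : ℕ)) ∧
  (∀ p : Fin j × Fin (n - j), ¬ (p.2 : ℕ) < (lam p.1 : ℕ) → D p = false) ∧
  ∀ p : Fin j × Fin (n - j), (p.2 : ℕ) < (lam p.1 : ℕ) → D p = false →
    ¬ ((∃ r' : Fin j, r' < p.1 ∧ D (r', p.2) = true) ∧
       (∃ c' : Fin (n - j), c' < p.2 ∧ D (p.1, c') = true))



lemma inv_swap_lt {n : ℕ} (u : Equiv.Perm (Fin n)) {a b : Fin n} (hab : a < b) (h : u a < u b) :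
    invCount u < invCount (u * Equiv.swap a b) := by
  unfold invCount
  set t := Equiv.swap a b with ht
  have htt : ∀ p, t (t p) = p := fun p => Equiv.swap_apply_self a b p
  have hta : t a = b := Equiv.swap_apply_left a b
  have htb : t b = a := Equiv.swap_apply_right a b
  have hto : ∀ p, p ≠ a → p ≠ b → t p = p := fun p h1 h2 => Equiv.swap_apply_of_ne_of_ne h1 h2
  let φ : Fin n × Fin n → Fin n × Fin n := fun p => if t p.1 < t p.2 then (t p.1, t p.2) else p
  set I := Finset.univ.filter fun p : Fin n × Fin n => p.1 < p.2 ∧ u p.2 < u p.1 with hI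
  have hinj : Set.InjOn φ (I : Set (Fin n × Fin n)) := by
    rintro ⟨p, q⟩ hp ⟨p', q'⟩ hp' he
    simp only [hI, Finset.coe_filter, Finset.mem_univ, true_and, Set.mem_ofPred_eq] at hp hp'
    simp only [φ] at he
    have := htt p; have := htt q; have := htt p'; have := htt q'
    split_ifs at he <;> simp only [Prod.mk.injEq] at he ⊢ <;> grind
  rw [← Finset.card_image_of_injOn hinj]
  apply Finset.card_lt_card
  rw [Finset.ssubset_iff_of_subset]
  · refine ⟨(a, b), ?_, ?_⟩
    · rw [Finset.mem_filter]; simp [hab, hta, htb, h]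
    · simp only [Finset.mem_image, not_exists, not_and]
      rintro ⟨p, q⟩ hp he
      simp only [hI, Finset.mem_filter, Finset.mem_univ, true_and] at hp
      simp only [φ] at he
      have := htt p; have := htt q
      split_ifs at he <;> simp only [Prod.mk.injEq] at he <;> grind
  · intro x hx
    simp only [Finset.mem_image] at hx
    obtain ⟨⟨p, q⟩, hp, rfl⟩ := hx
    simp only [hI, Finset.mem_filter, Finset.mem_univ, true_and] at hp
    rw [Finset.mem_filter]
    simp only [Finset.mem_univ, true_and, Equiv.Perm.coe_mul, Function.comp, φ]
    have := htt p; have := htt q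
    split_ifs with hc
    · simp_all
    · refine ⟨hp.1, ?_⟩
      by_cases h1 : p = a
      · subst h1
        by_cases h2 : q = b
        · grind
        · have := hto q (by grind) h2
          grind
      · by_cases h2 : q = b
        · have := hto p h1 (by grind)
          grind
        · by_cases h3 : p = b
          · have := hto q (by grind) (by grind)
            grind
          · have := hto p h1 h3
            by_cases h4 : q = a
            · grind
            · have := hto q h4 h2
              grind

lemma inv_swap_lt_iff {n : ℕ} (u : Equiv.Perm (Fin n)) {a b : Fin n} (hab : a < b) :
    invCount u < invCount (u * Equiv.swap a b) ↔ u a < u b := by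
  refine ⟨fun h => ?_, inv_swap_lt u hab⟩
  by_contra hc
  have hne : u a ≠ u b := fun h => hab.ne (u.injective h)
  have := inv_swap_lt (u * Equiv.swap a b) hab (by simp; omega)
  rw [mul_assoc, Equiv.swap_mul_self, mul_one] at this
  omega

/-- simple step -/
def IsSimp (n : ℕ) (s : Equiv.Perm (Fin n)) : Prop :=
  ∃ a b : Fin n, (b : ℕ) = a + 1 ∧ s = Equiv.swap a b

lemma IsSimp.mul_self {n : ℕ} {s : Equiv.Perm (Fin n)} (h : IsSimp n s) : s * s = 1 := by
  obtain ⟨a, b, -, rfl⟩ := h; simp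

lemma inv_simple {n : ℕ} (u s : Equiv.Perm (Fin n)) (hs : IsSimp n s)
    (h : invCount u < invCount (u * s)) :
    invCount (u * s) = invCount u + 1 := by
  obtain ⟨a, b, hab, rfl⟩ := hs
  have hlt : a < b := by rw [Fin.lt_def]; omega
  have hu := (inv_swap_lt_iff u hlt).1 h
  set t := Equiv.swap a b with ht
  have htt : ∀ p, t (t p) = p := fun p => Equiv.swap_apply_self a b p
  have hta : t a = b := Equiv.swap_apply_left a b
  have htb : t b = a := Equiv.swap_apply_right a b
  have hto : ∀ p, p ≠ a → p ≠ b → t p = p := fun p h1 h2 => Equiv.swap_apply_of_ne_of_ne h1 h2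
  have hmono : ∀ p q, p < q → ¬ (p = a ∧ q = b) → t p < t q := by
    intro p q hpq hn
    by_cases h1 : p = a
    · have := hto q (by grind) (by grind)
      have : b ≠ q := by grind
      grind
    · by_cases h2 : p = b
      · have := hto q (by grind) (by grind)
        grind
      · have := hto p h1 h2
        by_cases h3 : q = a
        · grind
        · by_cases h4 : q = b
          · grind
          · have := hto q h3 h4
            grind
  unfold invCount
  have : (Finset.univ.filter fun p : Fin n × Fin n => p.1 < p.2 ∧ (u * t) p.2 < (u * t) p.1) =
      insert (a, b) ((Finset.univ.filter fun p : Fin n × Fin n => p.1 < p.2 ∧ u p.2 < u p.1).image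
        (fun p => (t p.1, t p.2))) := by
    ext ⟨p, q⟩
    rw [Finset.mem_filter, Finset.mem_insert, Finset.mem_image]
    simp only [Finset.mem_filter, Finset.mem_univ, true_and,
      Prod.mk.injEq, Equiv.Perm.coe_mul, Function.comp, Prod.exists]
    constructor
    · rintro ⟨h1, h2⟩
      by_cases hc : p = a ∧ q = b
      · exact Or.inl hc
      · exact Or.inr ⟨t p, t q, ⟨hmono p q h1 hc, h2⟩, htt p, htt q⟩
    · rintro (⟨rfl, rfl⟩ | ⟨p', q', ⟨h1, h2⟩, rfl, rfl⟩)
      · exact ⟨hlt, by rw [hta, htb]; exact hu⟩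
      · refine ⟨hmono _ _ h1 ?_, by rwa [htt, htt]⟩
        rintro ⟨rfl, rfl⟩; exact absurd h2 (not_lt.2 hu.le)
  rw [this, Finset.card_insert_of_notMem, Finset.card_image_of_injective]
  · rintro ⟨p, q⟩ ⟨p', q'⟩ h; simpa using h
  · simp only [Finset.mem_image, Finset.mem_filter, Finset.mem_univ, true_and, Prod.mk.injEq,
      Prod.exists, not_exists, not_and]
    intro p q h1 h2 h3
    have := htt p; have := htt q; grind

lemma genA_eq {n m : ℕ} (h1 : 1 ≤ m) (h2 : m < n) :
    genA n m = Equiv.swap ⟨m - 1, by omega⟩ ⟨m, h2⟩ := by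
  unfold genA; rw [dif_pos ⟨h1, h2⟩]

lemma genA_simp {n m : ℕ} (h1 : 1 ≤ m) (h2 : m < n) : IsSimp n (genA n m) :=
  ⟨_, _, by simp; omega, genA_eq h1 h2⟩

lemma IsSimp.genA {n : ℕ} {s : Equiv.Perm (Fin n)} (h : IsSimp n s) :
    ∃ m, 1 ≤ m ∧ m < n ∧ s = genA n m := by
  obtain ⟨a, b, hab, rfl⟩ := h
  refine ⟨b, by omega, b.2, ?_⟩
  rw [genA_eq (by omega) b.2]
  congr 1
  ext; simp; omega

lemma refl_swap {n : ℕ} {t : Equiv.Perm (Fin n)} (h : IsReflectionA n t) :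
    ∃ a b, a < b ∧ t = Equiv.swap a b := by
  obtain ⟨w, m, h1, h2, rfl⟩ := h
  rw [genA_eq h1 h2, ← Equiv.swap_apply_apply]
  generalize ha : w ⟨m - 1, by omega⟩ = a
  generalize hb : w ⟨m, h2⟩ = b
  have : a ≠ b := by
    rintro rfl
    have := w.injective (ha.trans hb.symm)
    simp at this; omega
  rcases lt_or_gt_of_ne this with h | h
  · exact ⟨_, _, h, rfl⟩
  · exact ⟨_, _, h, Equiv.swap_comm _ _⟩

def bstep (n : ℕ) (u v : Equiv.Perm (Fin n)) : Prop :=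
  ∃ t, IsReflectionA n t ∧ v = u * t ∧ invCount u < invCount v

lemma IsSimp.refl {n : ℕ} {s : Equiv.Perm (Fin n)} (h : IsSimp n s) : IsReflectionA n s := by
  obtain ⟨m, h1, h2, rfl⟩ := h.genA
  exact ⟨1, m, h1, h2, by simp⟩

lemma simp_ne {n : ℕ} {s : Equiv.Perm (Fin n)} (h : IsSimp n s) (u : Equiv.Perm (Fin n)) :
    invCount u < invCount (u * s) ∨ invCount (u * s) < invCount u := by
  obtain ⟨a, b, hab, rfl⟩ := h
  have hlt : a < b := by rw [Fin.lt_def]; omega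
  rcases lt_or_gt_of_ne (show u a ≠ u b from fun h => hlt.ne (u.injective h)) with h | h
  · exact Or.inl (inv_swap_lt u hlt h)
  · right
    have := inv_swap_lt (u * Equiv.swap a b) hlt (by simpa)
    rwa [mul_assoc, Equiv.swap_mul_self, mul_one] at this

lemma bstep_simp {n : ℕ} {s : Equiv.Perm (Fin n)} (h : IsSimp n s) (u : Equiv.Perm (Fin n))
    (hl : invCount u < invCount (u * s)) : bruhatA n u (u * s) :=
  Relation.ReflTransGen.single ⟨s, h.refl, rfl, hl⟩

lemma bstep_simp' {n : ℕ} {s : Equiv.Perm (Fin n)} (h : IsSimp n s) (u : Equiv.Perm (Fin n))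
    (hl : invCount (u * s) < invCount u) : bruhatA n (u * s) u :=
  Relation.ReflTransGen.single ⟨s, h.refl, by rw [mul_assoc, h.mul_self, mul_one], hl⟩

lemma bstep_lift {n : ℕ} {u v s : Equiv.Perm (Fin n)} (hs : IsSimp n s) (h : bstep n u v) :
    v = u * s ∨ bstep n (u * s) (v * s) := by
  obtain ⟨t, ht, rfl, hlt⟩ := h
  by_cases hts : t = s
  · left; rw [hts]
  right
  refine ⟨s * t * s, ?_, ?_, ?_⟩
  · obtain ⟨w, m, h1, h2, rfl⟩ := ht
    refine ⟨s * w, m, h1, h2, ?_⟩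
    have : s⁻¹ = s := by rw [inv_eq_iff_mul_eq_one]; exact hs.mul_self
    simp only [mul_inv_rev, this, mul_assoc]
  · have := hs.mul_self
    calc u * t * s = u * (1 * t * s) := by group
      _ = u * (s * s * t * s) := by rw [this]
      _ = _ := by group
  · obtain ⟨a, b, hab, rfl⟩ := refl_swap ht
    have hu := (inv_swap_lt_iff u hab).1 hlt
    have e : u * Equiv.swap a b * s = u * s * Equiv.swap (s a) (s b) := by
      have : s⁻¹ = s := by rw [inv_eq_iff_mul_eq_one]; exact hs.mul_self
      rw [Equiv.swap_apply_apply, this]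
      simp only [← mul_assoc]
      rw [mul_assoc u s s, hs.mul_self, mul_one]
    rw [e]
    have hss : ∀ p, s (s p) = p := fun p => by
      have := hs.mul_self
      simpa using congrArg (fun f : Equiv.Perm (Fin n) => f p) this
    rw [inv_swap_lt_iff]
    · simpa [hss]
    · obtain ⟨c, d, hcd, rfl⟩ := hs
      have : ¬ (a = c ∧ b = d) := by rintro ⟨rfl, rfl⟩; exact hts rfl
      rw [Equiv.swap_apply_def, Equiv.swap_apply_def]
      split_ifs <;> simp only [Fin.lt_def, Fin.ext_iff] at * <;> omega

/-- smaller of `u`, `u s`. -/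
noncomputable def mn {n : ℕ} (s u : Equiv.Perm (Fin n)) : Equiv.Perm (Fin n) :=
  if invCount u < invCount (u * s) then u else u * s
noncomputable def mx {n : ℕ} (s u : Equiv.Perm (Fin n)) : Equiv.Perm (Fin n) :=
  if invCount u < invCount (u * s) then u * s else u

lemma mn_le {n : ℕ} {s : Equiv.Perm (Fin n)} (hs : IsSimp n s) (u) :
    bruhatA n (mn s u) u ∧ bruhatA n (mn s u) (u * s) ∧
    bruhatA n u (mx s u) ∧ bruhatA n (u * s) (mx s u) := by
  unfold mn mx
  split_ifs with h
  · exact ⟨.refl, bstep_simp hs u h, bstep_simp hs u h, .refl⟩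
  · have := (simp_ne hs u).resolve_left h
    exact ⟨bstep_simp' hs u this, .refl, .refl, bstep_simp' hs u this⟩

lemma mn_mul {n : ℕ} {s : Equiv.Perm (Fin n)} (hs : IsSimp n s) (u) :
    mn s (u * s) = mn s u ∧ mx s (u * s) = mx s u := by
  unfold mn mx
  rw [mul_assoc, hs.mul_self, mul_one]
  have := simp_ne hs u
  constructor <;> split_ifs <;> first | rfl | omega

lemma mn_step {n : ℕ} {u v s : Equiv.Perm (Fin n)} (hs : IsSimp n s) (h : bstep n u v) :
    bruhatA n (mn s u) (mn s v) ∧ bruhatA n (mx s u) (mx s v) := by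
  rcases bstep_lift hs h with rfl | h'
  · rw [(mn_mul hs u).1, (mn_mul hs u).2]; exact ⟨.refl, .refl⟩
  · have h1 : bruhatA n u v := Relation.ReflTransGen.single h
    have h2 : bruhatA n (u * s) (v * s) := Relation.ReflTransGen.single h'
    obtain ⟨a1, a2, a3, a4⟩ := mn_le hs u
    obtain ⟨b1, b2, b3, b4⟩ := mn_le hs v
    constructor
    · conv_rhs => unfold mn
      split_ifs
      · exact a1.trans h1
      · exact a2.trans h2
    · conv_lhs => unfold mx
      split_ifs
      · exact h2.trans b4
      · exact h1.trans b3

lemma mn_mono {n : ℕ} {u v s : Equiv.Perm (Fin n)} (hs : IsSimp n s) (h : bruhatA n u v) :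
    bruhatA n (mn s u) (mn s v) ∧ bruhatA n (mx s u) (mx s v) := by
  induction h with
  | refl => exact ⟨.refl, .refl⟩
  | tail _ h ih => exact ⟨ih.1.trans (mn_step hs h).1, ih.2.trans (mn_step hs h).2⟩

lemma bruhat_inv {n : ℕ} {u v : Equiv.Perm (Fin n)} (h : bruhatA n u v) :
    invCount u ≤ invCount v := by
  induction h with
  | refl => exact le_rfl
  | tail _ h ih => obtain ⟨t, _, _, h⟩ := h; omega

lemma lifting {n : ℕ} {x w s : Equiv.Perm (Fin n)} (hs : IsSimp n s)
    (hw : invCount w < invCount (w * s)) :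
    bruhatA n x (w * s) ↔ bruhatA n (if invCount x < invCount (x * s) then x else x * s) w := by
  have e1 : mn s (w * s) = w := by rw [(mn_mul hs w).1]; unfold mn; rw [if_pos hw]
  have e2 : mx s w = w * s := by unfold mx; rw [if_pos hw]
  change _ ↔ bruhatA n (mn s x) w
  constructor
  · intro h
    have := (mn_mono hs h).1
    rwa [e1] at this
  · intro h
    have := (mn_mono hs h).2
    have e3 : mx s (mn s x) = mx s x := by
      conv_lhs => rw [mn]
      split_ifs
      · rfl
      · exact (mn_mul hs x).2
    rw [e2, e3] at this
    exact (mn_le hs x).2.2.1.trans this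

/-- The simple generator attached to the box `(i, c)`. -/
def bx (n : ℕ) (p : ℕ × ℕ) : Equiv.Perm (Fin n) := genA n (p.1 + p.2 + 1)

noncomputable def wprod (n : ℕ) (T : Finset (ℕ × ℕ)) : List (ℕ × ℕ) → Equiv.Perm (Fin n)
  | [] => 1
  | p :: L => if p ∈ T then wprod n T L else wprod n T L * bx n p

/-- Positive distinguished subexpressions. -/
def PDS (n : ℕ) (T : Finset (ℕ × ℕ)) : List (ℕ × ℕ) → Prop
  | [] => True
  | p :: L => PDS n T L ∧ invCount (wprod n T L) < invCount (wprod n T L * bx n p)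

lemma wprod_congr (n : ℕ) (T T' : Finset (ℕ × ℕ)) (L : List (ℕ × ℕ))
    (h : ∀ p ∈ L, (p ∈ T ↔ p ∈ T')) :
    wprod n T L = wprod n T' L ∧ (PDS n T L ↔ PDS n T' L) := by
  induction L with
  | nil => exact ⟨rfl, Iff.rfl⟩
  | cons p L ih =>
    obtain ⟨h1, h2⟩ := ih (fun q hq => h q (List.mem_cons_of_mem _ hq))
    have h3 := h p List.mem_cons_self
    simp only [wprod, PDS, h1, h2, h3, and_self]

lemma invCount_one (n : ℕ) : invCount (1 : Equiv.Perm (Fin n)) = 0 := by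
  unfold invCount
  rw [Finset.card_eq_zero, Finset.filter_eq_empty_iff]
  rintro ⟨a, b⟩ - ⟨h1, h2⟩
  simp at h1 h2; omega

lemma bruhat_one {n : ℕ} {x : Equiv.Perm (Fin n)} : bruhatA n x 1 ↔ x = 1 := by
  constructor
  · intro h
    rcases Relation.ReflTransGen.cases_tail h with h | ⟨y, _, t, _, _, h⟩
    · exact h.symm
    · rw [invCount_one] at h; omega
  · rintro rfl; exact .refl

open Polynomial in
lemma pds_sum (n : ℕ) (L : List (ℕ × ℕ)) (hnd : L.Nodup) (hr : ∀ p ∈ L, p.1 + p.2 + 1 < n)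
    (h0 : PDS n ∅ L) :
    invCount (wprod n ∅ L) = L.length ∧ ∀ x,
      (∑ T ∈ L.toFinset.powerset,
        (if PDS n T L ∧ wprod n T L = x then (X : Polynomial ℤ) ^ T.card else 0)) =
      if bruhatA n x (wprod n ∅ L) then (X : Polynomial ℤ) ^ (L.length - invCount x) else 0 := by
  induction L with
  | nil =>
    refine ⟨invCount_one n, fun x => ?_⟩
    simp only [wprod, PDS, List.toFinset_nil, Finset.powerset_empty, Finset.sum_singleton, true_and,
      Finset.card_empty, bruhat_one, List.length_nil, Nat.zero_sub, eq_comm]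
  | cons p L ih =>
    have hs : IsSimp n (bx n p) := genA_simp (by omega) (hr p List.mem_cons_self)
    obtain ⟨hpL, hnd'⟩ := List.nodup_cons.1 hnd
    obtain ⟨h0', hasc⟩ := h0
    obtain ⟨ih1, ih2⟩ := ih hnd' (fun q hq => hr q (List.mem_cons_of_mem _ hq)) h0'
    have ew : wprod n ∅ (p :: L) = wprod n ∅ L * bx n p := by simp [wprod]
    have hss := hs.mul_self
    refine ⟨by rw [ew, inv_simple _ _ hs hasc, ih1, List.length_cons], fun x => ?_⟩
    have hp' : p ∉ L.toFinset := by simpa using hpL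
    rw [List.toFinset_cons, Finset.sum_powerset_insert hp', ew, lifting hs hasc]
    have e1 : ∀ T ∈ L.toFinset.powerset,
        (if PDS n T (p :: L) ∧ wprod n T (p :: L) = x then (X : Polynomial ℤ) ^ T.card else 0) =
        if invCount x < invCount (x * bx n p) then 0 else
          (if PDS n T L ∧ wprod n T L = x * bx n p then (X : Polynomial ℤ) ^ T.card else 0) := by
      intro T hT
      have hpT : p ∉ T := fun h => hp' (Finset.mem_powerset.1 hT h)
      simp only [wprod, PDS, if_neg hpT]
      have hx : wprod n T L * bx n p = x ↔ wprod n T L = x * bx n p := by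
        constructor
        · rintro rfl; rw [mul_assoc, hss, mul_one]
        · intro h; rw [h, mul_assoc, hss, mul_one]
      simp only [hx]
      split_ifs with h1 h2 h3 h4 h5
      · obtain ⟨⟨_, h⟩, h'⟩ := h1
        rw [h', mul_assoc, hss, mul_one] at h; omega
      · rfl
      · exact absurd ⟨h1.1.1, h1.2⟩ h3
      · rfl
      · exfalso; apply h1
        refine ⟨⟨h5.1, ?_⟩, h5.2⟩
        rw [h5.2, mul_assoc, hss, mul_one]
        have := simp_ne hs x
        omega
      · rfl
    have e2 : ∀ T ∈ L.toFinset.powerset,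
        (if PDS n (insert p T) (p :: L) ∧ wprod n (insert p T) (p :: L) = x then
          (X : Polynomial ℤ) ^ (insert p T).card else 0) =
        if invCount x < invCount (x * bx n p) then
          X * (if PDS n T L ∧ wprod n T L = x then (X : Polynomial ℤ) ^ T.card else 0) else 0 := by
      intro T hT
      have hpT : p ∉ T := fun h => hp' (Finset.mem_powerset.1 hT h)
      obtain ⟨c1, c2⟩ := wprod_congr n (insert p T) T L (fun q hq => by
        have : q ≠ p := by rintro rfl; exact hpL hq
        simp [this])
      simp only [wprod, PDS, if_pos (Finset.mem_insert_self p T), c1, c2,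
        Finset.card_insert_of_notMem hpT]
      split_ifs with h1 h2 h3 h4 h5
      · rw [pow_succ']
      · exact absurd ⟨h1.1.1, h1.2⟩ h3
      · exact absurd (h1.2 ▸ h1.1.2) h2
      · exact absurd ⟨⟨h5.1, h5.2 ▸ h4⟩, h5.2⟩ h1
      · simp
      · rfl
    rw [Finset.sum_congr rfl e1, Finset.sum_congr rfl e2]
    by_cases hx : invCount x < invCount (x * bx n p)
    · simp only [if_pos hx, Finset.sum_const_zero, zero_add, ← Finset.mul_sum, ih2]
      split_ifs with hb
      · have := bruhat_inv hb
        rw [← pow_succ', List.length_cons]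
        congr 1; omega
      · simp
    · simp only [if_neg hx, Finset.sum_const_zero, add_zero, ih2]
      have h3 := (simp_ne hs x).resolve_left hx
      have h4 := inv_simple (x * bx n p) _ hs (by rwa [mul_assoc, hss, mul_one])
      rw [mul_assoc, hss, mul_one] at h4
      split_ifs with hb
      · rw [List.length_cons, h4]
        congr 1; omega
      · rfl

open Polynomial in
lemma pds_sum' (n : ℕ) (L : List (ℕ × ℕ)) (hnd : L.Nodup) (hr : ∀ p ∈ L, p.1 + p.2 + 1 < n)
    (h0 : PDS n ∅ L) :
      (∑ T ∈ L.toFinset.powerset,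
        (if PDS n T L then (X : Polynomial ℤ) ^ T.card else 0)) =
      ∑ x, if bruhatA n x (wprod n ∅ L) then
        (X : Polynomial ℤ) ^ (invCount (wprod n ∅ L) - invCount x) else 0 := by
  obtain ⟨h1, h2⟩ := pds_sum n L hnd hr h0
  rw [h1]
  simp only [← h2]
  rw [Finset.sum_comm]
  refine Finset.sum_congr rfl fun T _ => ?_
  by_cases h : PDS n T L
  · simp [h]
  · simp [h]

noncomputable def fprod (T : Finset (ℕ × ℕ)) : List (ℕ × ℕ) → ℕ → ℕ
  | [] => id
  | p :: L => if p ∈ T then fprod T L else fprod T L ∘ Equiv.swap (p.1 + p.2) (p.1 + p.2 + 1)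

def fPDS (T : Finset (ℕ × ℕ)) : List (ℕ × ℕ) → Prop
  | [] => True
  | p :: L => fPDS T L ∧ fprod T L (p.1 + p.2) < fprod T L (p.1 + p.2 + 1)

def rowAux (k A : ℕ) (B : List (ℕ × ℕ)) : ℕ → List (ℕ × ℕ)
  | 0 => B
  | m + 1 => (k, A - 1 - m) :: rowAux k A B m

def RL (a : ℕ → ℕ) : ℕ → List (ℕ × ℕ)
  | 0 => []
  | k + 1 => rowAux k (a k) (RL a k) (a k)

lemma fprod_inj (T : Finset (ℕ × ℕ)) (L) : Function.Injective (fprod T L) := by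
  induction L with
  | nil => exact fun _ _ h => h
  | cons p L ih =>
    unfold fprod
    split_ifs
    · exact ih
    · exact ih.comp (Equiv.injective _)

lemma fprod_fix (T : Finset (ℕ × ℕ)) (L) (K : ℕ) (h : ∀ p ∈ L, p.1 + p.2 + 1 < K) :
    (∀ p, K ≤ p → fprod T L p = p) ∧ (∀ p, p < K → fprod T L p < K) := by
  induction L with
  | nil => exact ⟨fun _ _ => rfl, fun _ h => h⟩
  | cons p L ih =>
    obtain ⟨i1, i2⟩ := ih (fun q hq => h q (List.mem_cons_of_mem _ hq))
    have hp := h p List.mem_cons_self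
    unfold fprod
    split_ifs
    · exact ⟨i1, i2⟩
    · refine ⟨fun q hq => ?_, fun q hq => ?_⟩
      · rw [Function.comp, Equiv.swap_apply_of_ne_of_ne (by omega) (by omega)]
        exact i1 q hq
      · apply i2
        rw [Equiv.swap_apply_def]
        split_ifs <;> omega

lemma mem_rowAux (k A : ℕ) (B) (m : ℕ) (hm : m ≤ A) (p : ℕ × ℕ) :
    p ∈ rowAux k A B m ↔ p ∈ B ∨ (p.1 = k ∧ A - m ≤ p.2 ∧ p.2 < A) := by
  induction m with
  | zero => simp [rowAux]
  | succ m ih =>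
    rw [rowAux, List.mem_cons, ih (by omega), Prod.ext_iff]
    simp only
    grind

lemma mem_RL (a : ℕ → ℕ) (k : ℕ) (p : ℕ × ℕ) : p ∈ RL a k ↔ p.1 < k ∧ p.2 < a p.1 := by
  induction k with
  | zero => simp [RL]
  | succ k ih =>
    rw [RL, mem_rowAux _ _ _ _ le_rfl, ih]
    grind

lemma nodup_rowAux (k A : ℕ) (B) (hB : B.Nodup) (hk : ∀ p ∈ B, p.1 ≠ k) (m : ℕ) (hm : m ≤ A) :
    (rowAux k A B m).Nodup := by
  induction m with
  | zero => exact hB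
  | succ m ih =>
    rw [rowAux, List.nodup_cons, mem_rowAux _ _ _ _ (by omega)]
    refine ⟨?_, ih (by omega)⟩
    rintro (h | h)
    · exact hk _ h rfl
    · simp only at h; omega

lemma nodup_RL (a : ℕ → ℕ) (k : ℕ) : (RL a k).Nodup := by
  induction k with
  | zero => simp [RL]
  | succ k ih =>
    refine nodup_rowAux _ _ _ ih (fun p hp => ?_) _ le_rfl
    rw [mem_RL] at hp; omega

lemma nxt_ex (t : ℕ → Prop) (A c : ℕ) : ∃ x, c ≤ x ∧ (t x ∨ A ≤ x) :=
  ⟨max c A, le_max_left _ _, Or.inr (le_max_right _ _)⟩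

noncomputable def nxt (t : ℕ → Prop) (A c : ℕ) : ℕ := Nat.find (nxt_ex t A c)

lemma nxt_ge (t : ℕ → Prop) (A c : ℕ) : c ≤ nxt t A c := (Nat.find_spec (nxt_ex t A c)).1
lemma nxt_spec (t : ℕ → Prop) (A c : ℕ) : t (nxt t A c) ∨ A ≤ nxt t A c :=
  (Nat.find_spec (nxt_ex t A c)).2
lemma nxt_le (t : ℕ → Prop) (A c x : ℕ) (h : c ≤ x) (h2 : t x ∨ A ≤ x) : nxt t A c ≤ x :=
  Nat.find_min' (nxt_ex t A c) ⟨h, h2⟩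
lemma nxt_A (t : ℕ → Prop) (A : ℕ) : nxt t A A = A :=
  le_antisymm (nxt_le _ _ _ _ le_rfl (Or.inr le_rfl)) (nxt_ge _ _ _)
lemma nxt_pos (t : ℕ → Prop) (A c : ℕ) (h : t c) : nxt t A c = c :=
  le_antisymm (nxt_le _ _ _ _ le_rfl (Or.inl h)) (nxt_ge _ _ _)
lemma nxt_neg (t : ℕ → Prop) (A c : ℕ) (h : ¬ t c) (hc : c < A) :
    nxt t A c = nxt t A (c + 1) := by
  refine le_antisymm (nxt_le _ _ _ _ ?_ (nxt_spec _ _ _)) (nxt_le _ _ _ _ ?_ (nxt_spec _ _ _))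
  · have := nxt_ge t A (c + 1); omega
  · have := nxt_ge t A c
    rcases this.eq_or_lt with e | e
    · have := nxt_spec t A c
      rw [← e] at this
      rcases this with h' | h'
      · exact absurd h' h
      · omega
    · exact e

lemma row_formula (T : Finset (ℕ × ℕ)) (k A : ℕ) (B) (m : ℕ) (hm : m ≤ A) :
    (∀ p < k + (A - m), fprod T (rowAux k A B m) p = fprod T B p) ∧
    (fprod T (rowAux k A B m) (k + (A - m)) =
      fprod T B (k + nxt (fun d => (k, d) ∈ T) A (A - m))) ∧
    (∀ d, A - m ≤ d → d < A → fprod T (rowAux k A B m) (k + d + 1) =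
      if (k, d) ∈ T then fprod T B (k + nxt (fun d => (k, d) ∈ T) A (d + 1))
      else fprod T B (k + d)) ∧
    (∀ p, k + A < p → fprod T (rowAux k A B m) p = fprod T B p) ∧
    (fPDS T (rowAux k A B m) ↔ fPDS T B ∧ ∀ d, A - m ≤ d → d < A →
      fprod T B (k + d) < fprod T B (k + nxt (fun d => (k, d) ∈ T) A (d + 1))) := by
  set t : ℕ → Prop := fun d => (k, d) ∈ T with ht
  induction m with
  | zero =>
    refine ⟨fun _ _ => rfl, ?_, fun d h1 h2 => by omega, fun _ _ => rfl, ?_⟩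
    · rw [Nat.sub_zero, nxt_A]; rfl
    · constructor
      · exact fun h => ⟨h, fun d h1 h2 => by omega⟩
      · exact fun h => h.1
  | succ m ih =>
    obtain ⟨i1, i2, i3, i4, i5⟩ := ih (by omega)
    obtain ⟨c, hc⟩ : ∃ c, A = c + m + 1 := ⟨A - m - 1, by omega⟩
    have e1 : A - (m + 1) = c := by omega
    have e2 : A - 1 - m = c := by omega
    have e3 : A - m = c + 1 := by omega
    rw [e3] at i1 i2 i3 i5
    simp only [rowAux, fprod, fPDS, e1, e2]
    rw [i5, i1 (k + c) (by omega), add_assoc k c 1, i2]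
    refine ⟨?_, ?_, ?_, ?_, ?_⟩
    · intro p hp
      split_ifs
      · exact i1 p (by omega)
      · rw [Function.comp, Equiv.swap_apply_of_ne_of_ne (by omega) (by omega)]
        exact i1 p (by omega)
    · split_ifs with h
      · rw [nxt_pos t A c h]; exact i1 _ (by omega)
      · rw [nxt_neg t A c h (by omega), Function.comp, Equiv.swap_apply_left]
        exact i2
    · intro d h1 h2
      rcases h1.eq_or_lt with rfl | h1
      · split_ifs with h
        · exact i2
        · rw [Function.comp, add_assoc, Equiv.swap_apply_right]
          exact i1 _ (by omega)
      · have := i3 d (by omega) h2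
        rw [← this]
        have e : (if (k, c) ∈ T then fprod T (rowAux k A B m) else
            fprod T (rowAux k A B m) ∘ Equiv.swap (k + c) (k + (c + 1))) (k + d + 1)
            = fprod T (rowAux k A B m) (k + d + 1) := by
          split_ifs
          · rfl
          · rw [Function.comp, Equiv.swap_apply_of_ne_of_ne (by omega) (by omega)]
        exact e
    · intro p hp
      split_ifs
      · exact i4 p hp
      · rw [Function.comp, Equiv.swap_apply_of_ne_of_ne (by omega) (by omega)]
        exact i4 p hp
    · constructor
      · rintro ⟨⟨h1, h2⟩, h3⟩
        refine ⟨h1, fun d hd hd' => ?_⟩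
        rcases hd.eq_or_lt with rfl | hd
        · exact h3
        · exact h2 d hd hd'
      · rintro ⟨h1, h2⟩
        exact ⟨⟨h1, fun d hd => h2 d (by omega)⟩, h2 c le_rfl (by omega)⟩

lemma rec1 (h : ℕ → ℕ) (t : ℕ → Prop) (A : ℕ) (hA : ∀ d < A, h d < h A) :
    (∀ d < A, h d < h (nxt t A (d + 1))) ↔ ∀ x < A, t x → ∀ d < x, h d < h x := by
  constructor
  · intro H x hx tx
    have : ∀ e d, d + e + 1 = x → h d < h x := by
      intro e
      induction e using Nat.strong_induction_on with
      | _ e ih =>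
        intro d hd
        have h1 := H d (by omega)
        have h2 := nxt_ge t A (d + 1)
        have h3 := nxt_le t A (d + 1) x (by omega) (Or.inl tx)
        rcases h3.eq_or_lt with h3 | h3
        · rwa [h3] at h1
        · exact h1.trans (ih (x - nxt t A (d + 1) - 1) (by omega) _ (by omega))
    intro d hd
    exact this (x - d - 1) d (by omega)
  · intro H d hd
    have h2 := nxt_ge t A (d + 1)
    have h3 := nxt_le t A (d + 1) A (by omega) (Or.inr le_rfl)
    rcases h3.eq_or_lt with h3 | h3
    · rw [h3]; exact hA d hd
    · exact H _ h3 ((nxt_spec t A (d + 1)).resolve_right (by omega)) _ (by omega)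

lemma rec2 (h u : ℕ → ℕ) (t : ℕ → Prop) (A : ℕ)
    (hA : ∀ d, A ≤ d → ∀ d' < d, h d' < h d)
    (hr : ∀ x < A, t x → ∀ d < x, h d < h x)
    (hu1 : ∀ d < A, t d → u d = h (nxt t A (d + 1)))
    (hu2 : ∀ d < A, ¬ t d → u d = h d)
    (hu3 : ∀ d, A ≤ d → u d = h (d + 1)) (d : ℕ) :
    (∃ d' < d, u d < u d') ↔
      ((∃ d' < d, h d < h d') ∨ (d < A ∧ ¬ t d ∧ ∃ d' < d, t d')) := by
  have hrec : ∀ y, (t y ∨ A ≤ y) → ∀ d < y, h d < h y := by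
    intro y hy
    by_cases hyA : A ≤ y
    · exact hA y hyA
    · exact hr y (by omega) (hy.resolve_right hyA)
  by_cases hdA : A ≤ d
  · have h1 : ∀ d' < d, u d' < u d := by
      intro d' hd'
      rw [hu3 d hdA]
      by_cases h1 : A ≤ d'
      · rw [hu3 d' h1]; exact hA _ (by omega) _ (by omega)
      · by_cases h2 : t d'
        · rw [hu1 d' (by omega) h2]
          have := nxt_le t A (d' + 1) A (by omega) (Or.inr le_rfl)
          exact hA _ (by omega) _ (by omega)
        · rw [hu2 d' (by omega) h2]; exact hA _ (by omega) _ (by omega)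
    constructor
    · rintro ⟨d', h2, h3⟩; have := h1 d' h2; omega
    · rintro (⟨d', h2, h3⟩ | h2)
      · have := hA d hdA d' h2; omega
      · omega
  · push Not at hdA
    by_cases htd : t d
    · constructor
      · rintro ⟨d', h2, h3⟩
        exfalso
        rw [hu1 d hdA htd] at h3
        have g1 := nxt_ge t A (d + 1)
        have g2 := hrec _ (nxt_spec t A (d + 1))
        by_cases h4 : t d'
        · rw [hu1 d' (by omega) h4] at h3
          have := nxt_le t A (d' + 1) d (by omega) (Or.inl htd)
          have := g2 (nxt t A (d' + 1)) (by omega)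
          omega
        · rw [hu2 d' (by omega) h4] at h3
          have := g2 d' (by omega)
          omega
      · rintro (⟨d', h2, h3⟩ | h2)
        · have := hr d hdA htd d' h2; omega
        · exact absurd htd h2.2.1
    · rw [hu2 d hdA htd]
      by_cases hex : ∃ d' < d, t d'
      · refine iff_of_true ?_ (Or.inr ⟨hdA, htd, hex⟩)
        obtain ⟨d', h1, h2⟩ := hex
        set e := Nat.findGreatest t d with he
        have h3 : t e := Nat.findGreatest_spec h1.le h2
        have h4 : e ≤ d := Nat.findGreatest_le d
        have h5 : e ≠ d := fun h => htd (h ▸ h3)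
        refine ⟨e, by omega, ?_⟩
        rw [hu1 e (by omega) h3]
        apply hrec _ (nxt_spec t A (e + 1))
        by_contra hc
        push Not at hc
        have h6 := (nxt_spec t A (e + 1)).resolve_right (by omega)
        have h7 := Nat.le_findGreatest hc h6
        have := nxt_ge t A (e + 1)
        omega
      · have : ∀ d' < d, u d' = h d' := fun d' hd' =>
          hu2 d' (by omega) (fun h => hex ⟨d', hd', h⟩)
        constructor
        · rintro ⟨d', h1, h2⟩
          exact Or.inl ⟨d', h1, by rwa [this d' h1] at h2⟩
        · rintro (⟨d', h1, h2⟩ | h1)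
          · exact ⟨d', h1, by rwa [this d' h1]⟩
          · exact absurd h1.2.2 hex

def LeUp (a : ℕ → ℕ) (k : ℕ) (T : Finset (ℕ × ℕ)) : Prop :=
  ∀ i < k, ∀ c < a i, (i, c) ∈ T → ∀ i' < i, c < a i' → (i', c) ∉ T → ∀ c' < c, (i', c') ∉ T

lemma RL_fresh (a : ℕ → ℕ) (ha : Monotone a) (k : ℕ) (T : Finset (ℕ × ℕ)) (d : ℕ) (hd : a k ≤ d) :
    fprod T (RL a k) (k + d) = k + d ∧ ∀ d' < d, fprod T (RL a k) (k + d') < fprod T (RL a k) (k + d) := by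
  obtain ⟨h1, h2⟩ := fprod_fix T (RL a k) (k + d) (by
    intro p hp
    rw [mem_RL] at hp
    have := ha hp.1.le
    omega)
  refine ⟨h1 _ le_rfl, fun d' hd' => ?_⟩
  rw [h1 _ le_rfl]; exact h2 _ (by omega)

lemma le_main (a : ℕ → ℕ) (ha : Monotone a) (T : Finset (ℕ × ℕ)) (k : ℕ) :
    (fPDS T (RL a k) ↔ LeUp a k T) ∧
    (LeUp a k T → ∀ d, (∃ d' < d, fprod T (RL a k) (k + d) < fprod T (RL a k) (k + d')) ↔
      ∃ i < k, d < a i ∧ (i, d) ∉ T ∧ ∃ c' < d, (i, c') ∈ T) := by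
  induction k with
  | zero =>
    refine ⟨by simp [RL, fPDS, LeUp], fun _ d => ?_⟩
    simp [RL, fprod]; omega
  | succ k ih =>
    obtain ⟨ih1, ih2⟩ := ih
    obtain ⟨f1, f2, f3, f4, f5⟩ := row_formula T k (a k) (RL a k) (a k) le_rfl
    rw [Nat.sub_self] at f1 f2 f3 f5
    have hfr := RL_fresh a ha k T
    have hinj := fprod_inj T (RL a k)
    set f := fprod T (RL a k) with hf
    set t : ℕ → Prop := fun d => (k, d) ∈ T with ht
    have r1 := rec1 (fun d => f (k + d)) t (a k) (fun d hd => (hfr (a k) le_rfl).2 d hd)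
    have hle : LeUp a (k + 1) T ↔ LeUp a k T ∧
        ∀ x < a k, t x → ¬ ∃ i < k, x < a i ∧ (i, x) ∉ T ∧ ∃ c' < x, (i, c') ∈ T := by
      constructor
      · intro h
        refine ⟨fun i hi => h i (by omega), fun x hx hxt => ?_⟩
        rintro ⟨i, hi, h1, h2, c', h3, h4⟩
        exact h k (by omega) x hx hxt i hi h1 h2 c' h3 h4
      · rintro ⟨h1, h2⟩ i hi c hc hiT i' hi' hc' hn c' hcc hT
        rcases Nat.lt_succ_iff_lt_or_eq.1 hi with hi | rfl
        · exact h1 i hi c hc hiT i' hi' hc' hn c' hcc hT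
        · exact h2 c hc hiT ⟨i', hi', hc', hn, c', hcc, hT⟩
    have hkey : LeUp a k T → ((∀ x < a k, t x → ∀ d < x, f (k + d) < f (k + x)) ↔
        ∀ x < a k, t x → ¬ ∃ i < k, x < a i ∧ (i, x) ∉ T ∧ ∃ c' < x, (i, c') ∈ T) := by
      intro h
      refine forall_congr' fun x => forall_congr' fun _ => forall_congr' fun _ => ?_
      rw [← ih2 h x]
      push Not
      refine forall_congr' fun d => forall_congr' fun hd => ?_
      have : f (k + d) ≠ f (k + x) := fun h => by have := hinj h; omega
      omega
    have hrow : fPDS T (RL a (k + 1)) ↔ LeUp a (k + 1) T := by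
      rw [RL, f5, ih1, hle]
      refine and_congr_right fun h => ?_
      rw [← hkey h, ← r1]
      simp
    refine ⟨hrow, fun h d => ?_⟩
    obtain ⟨h1, h2⟩ := hle.1 h
    have h3 := (hkey h1).2 h2
    have r2 := rec2 (fun d => f (k + d)) (fun d => fprod T (RL a (k + 1)) (k + 1 + d)) t (a k)
      (fun d hd => (hfr d hd).2) h3
      (fun d hd htd => by
        have := f3 d (by omega) hd
        rw [if_pos htd] at this
        simp only [RL]
        rw [← this]; congr 1; omega)
      (fun d hd htd => by
        have := f3 d (by omega) hd
        rw [if_neg htd] at this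
        simp only [RL]
        rw [← this]; congr 1; omega)
      (fun d hd => by
        have := f4 (k + 1 + d) (by omega)
        simp only [RL]
        rw [this]; congr 1; omega) d
    rw [r2, ih2 h1 d]
    constructor
    · rintro (⟨i, hi, g⟩ | ⟨g, g'⟩)
      · exact ⟨i, by omega, g⟩
      · exact ⟨k, by omega, g, g'⟩
    · rintro ⟨i, hi, g⟩
      rcases Nat.lt_succ_iff_lt_or_eq.1 hi with hi | rfl
      · exact Or.inl ⟨i, hi, g⟩
      · exact Or.inr g

lemma RL_empty (a : ℕ → ℕ) (ha : Monotone a) (k : ℕ) :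
    (∀ i < k, fprod ∅ (RL a k) i = i + a i) ∧
    ∀ p q, k ≤ p → p < q → fprod ∅ (RL a k) p < fprod ∅ (RL a k) q := by
  constructor
  · induction k with
    | zero => intro i hi; omega
    | succ k ih =>
      obtain ⟨f1, f2, -⟩ := row_formula ∅ k (a k) (RL a k) (a k) le_rfl
      intro i hi
      rcases Nat.lt_succ_iff_lt_or_eq.1 hi with hi | rfl
      · rw [RL, f1 i (by omega), ih i hi]
      · rw [Nat.sub_self] at f2
        rw [RL]
        refine f2.trans ?_
        have : nxt (fun d => (i, d) ∈ (∅ : Finset (ℕ × ℕ))) (a i) 0 = a i := by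
          refine le_antisymm (nxt_le _ _ _ _ (by omega) (Or.inr le_rfl)) ?_
          have := nxt_spec (fun d => (i, d) ∈ (∅ : Finset (ℕ × ℕ))) (a i) 0
          simpa using this
        rw [this]
        exact (RL_fresh a ha i ∅ (a i) le_rfl).1
  · intro p q hp hpq
    have h := (le_main a ha ∅ k).2 (by simp [LeUp]) (q - k)
    have hinj := fprod_inj ∅ (RL a k)
    by_contra hc
    have hne : fprod ∅ (RL a k) p ≠ fprod ∅ (RL a k) q := fun h => by have := hinj h; omega
    have := h.1 ⟨p - k, by omega, by
      rw [show k + (q - k) = q by omega, show k + (p - k) = p by omega]; omega⟩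
    simp at this

lemma transfer (n : ℕ) (T : Finset (ℕ × ℕ)) (L : List (ℕ × ℕ)) (hr : ∀ p ∈ L, p.1 + p.2 + 1 < n) :
    (∀ i : Fin n, ((wprod n T L i : Fin n) : ℕ) = fprod T L i) ∧ (PDS n T L ↔ fPDS T L) := by
  induction L with
  | nil => exact ⟨fun i => rfl, Iff.rfl⟩
  | cons p L ih =>
    obtain ⟨i1, i2⟩ := ih (fun q hq => hr q (List.mem_cons_of_mem _ hq))
    have hp := hr p List.mem_cons_self
    have hb : bx n p = Equiv.swap ⟨p.1 + p.2, by omega⟩ ⟨p.1 + p.2 + 1, hp⟩ := by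
      unfold bx; rw [genA_eq (by omega) hp]; rfl
    constructor
    · intro i
      simp only [wprod, fprod]
      split_ifs
      · exact i1 i
      · rw [hb, Equiv.Perm.mul_apply, i1, Function.comp]
        congr 1
        rw [Equiv.swap_apply_def, Equiv.swap_apply_def]
        simp only [Fin.ext_iff]
        split_ifs <;> rfl
    · simp only [PDS, fPDS, i2]
      rw [hb, inv_swap_lt_iff _ (by rw [Fin.lt_def]; simp), Fin.lt_def, i1, i1]

def Gr (n j : ℕ) (w : Equiv.Perm (Fin n)) : Prop :=
  ∀ p q : Fin n, p < q → ((q : ℕ) < j ∨ j ≤ (p : ℕ)) → w p < w q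

lemma minrep_iff (n j : ℕ) (w : Equiv.Perm (Fin n)) : IsMinRep n j w ↔ Gr n j w := by
  constructor
  · intro h
    have h1 : ∀ p q : Fin n, (q : ℕ) = p + 1 → ((q : ℕ) < j ∨ j ≤ (p : ℕ)) → w p < w q := by
      intro p q hpq hj
      have hlt : p < q := by rw [Fin.lt_def]; omega
      have hg : genA n q = Equiv.swap p q := by
        rw [genA_eq (by omega) q.2]; congr 1; ext; simp; omega
      have h2 := h (genA n q) (Subgroup.subset_closure ⟨q, by omega, q.2, by omega, rfl⟩)
      rw [hg] at h2
      by_contra hc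
      have hne : w p ≠ w q := fun h => hlt.ne (w.injective h)
      have h3 := inv_swap_lt (w * Equiv.swap p q) hlt (by simp; omega)
      rw [mul_assoc, Equiv.swap_mul_self, mul_one] at h3
      omega
    have h2 : ∀ e : ℕ, ∀ p q : Fin n, (q : ℕ) = p + e + 1 → ((q : ℕ) < j ∨ j ≤ (p : ℕ)) →
        w p < w q := by
      intro e
      induction e with
      | zero => intro p q hpq; exact h1 p q hpq
      | succ e ih =>
        intro p q hpq hj
        have hb : (p : ℕ) + e + 1 < n := by have := q.2; omega
        exact (ih p ⟨p + e + 1, hb⟩ rfl (by simp only; omega)).trans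
          (h1 ⟨p + e + 1, hb⟩ q (by simp only; omega) (by simp only; omega))
    intro p q hpq hj
    rw [Fin.lt_def] at hpq
    exact h2 (q - p - 1) p q (by omega) hj
  · intro h g hg
    have hpres : ∀ p : Fin n, (g p : ℕ) < j ↔ (p : ℕ) < j := by
      induction hg using Subgroup.closure_induction with
      | mem x hx =>
        obtain ⟨m, h1, h2, h3, rfl⟩ := hx
        intro p
        rw [genA_eq h1 h2, Equiv.swap_apply_def]
        split_ifs with e1 e2
        · subst e1; simp only; omega
        · subst e2; simp only; omega
        · rfl
      | one => intro p; rfl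
      | mul x y _ _ hx hy => intro p; rw [Equiv.Perm.mul_apply, hx, hy]
      | inv x _ hx => intro p; rw [← hx (x⁻¹ p)]; simp
    unfold invCount
    refine Finset.card_le_card_of_injOn (fun p => (g⁻¹ p.1, g⁻¹ p.2)) ?_ ?_
    · rintro ⟨p, q⟩ hp
      rw [Finset.mem_coe, Finset.mem_filter] at hp
      rw [Finset.mem_coe, Finset.mem_filter]
      obtain ⟨-, h1, h2⟩ := hp
      simp only at h1 h2
      refine ⟨Finset.mem_univ _, ?_, by simpa using h2⟩
      have h3 : ¬ ((q : ℕ) < j ∨ j ≤ (p : ℕ)) := fun h3 => absurd (h p q h1 h3) (by omega)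
      have h4 := hpres (g⁻¹ p)
      have h5 := hpres (g⁻¹ q)
      rw [show g (g⁻¹ p) = p by simp] at h4
      rw [show g (g⁻¹ q) = q by simp] at h5
      rw [Fin.lt_def]
      simp only
      omega
    · rintro ⟨p, q⟩ _ ⟨p', q'⟩ _ he
      simpa using he

lemma gr_unique_aux (n j : ℕ) (w w' : Equiv.Perm (Fin n)) (hw' : Gr n j w')
    (q : Fin n) (hq : j ≤ (q : ℕ)) (ih : ∀ p < q, w p = w' p) : ¬ w q < w' q := by
  intro hlt
  obtain ⟨z, hz⟩ := w'.surjective (w q)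
  rcases lt_trichotomy z q with h | h | h
  · rw [← ih z h] at hz; exact h.ne (w.injective hz)
  · subst h; omega
  · have := hw' q z h (Or.inr hq); omega

lemma gr_unique (n j : ℕ) (w w' : Equiv.Perm (Fin n)) (hw : Gr n j w) (hw' : Gr n j w')
    (h : ∀ p : Fin n, (p : ℕ) < j → w p = w' p) : w = w' := by
  have : ∀ m : ℕ, ∀ q : Fin n, (q : ℕ) = m → w q = w' q := by
    intro m
    induction m using Nat.strong_induction_on with
    | _ m ih =>
      intro q hq
      by_cases hj : (q : ℕ) < j
      · exact h q hj
      · have h1 := gr_unique_aux n j w w' hw' q (by omega) (fun p hp => ih p (by omega) p rfl)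
        have h2 := gr_unique_aux n j w' w hw q (by omega) (fun p hp => (ih p (by omega) p rfl).symm)
        omega
  exact Equiv.ext fun q => this q q rfl

lemma gr_gap (n j : ℕ) (w : Equiv.Perm (Fin n)) (hw : Gr n j w) (p q : Fin n)
    (hpq : p ≤ q) (hq : (q : ℕ) < j) : (w p : ℕ) + (q - p) ≤ w q := by
  have : ∀ e : ℕ, ∀ q : Fin n, (q : ℕ) = p + e → (q : ℕ) < j → (w p : ℕ) + e ≤ w q := by
    intro e
    induction e with
    | zero => intro q h _; have : q = p := Fin.ext h; subst this; simp
    | succ e ih =>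
      intro q h h'
      have hb : (p : ℕ) + e < n := by have := q.2; omega
      have h1 := ih ⟨p + e, hb⟩ rfl (by simp only; omega)
      have h2 := hw ⟨p + e, hb⟩ q (by rw [Fin.lt_def]; simp only; omega) (Or.inl h')
      rw [Fin.lt_def] at h2
      omega
  exact this (q - p) q (by rw [Fin.le_def] at hpq; omega) hq

/-- row lengths from the top row. -/
def rowLen (n j : ℕ) (hj : 1 ≤ j) (lam : Fin j → Fin (n - j + 1)) (i : ℕ) : ℕ :=
  lam ⟨j - 1 - i, by omega⟩

noncomputable def wOf (n j : ℕ) (hj : 1 ≤ j) (lam : Fin j → Fin (n - j + 1)) :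
    Equiv.Perm (Fin n) := wprod n ∅ (RL (rowLen n j hj lam) j)

def Anti (n j : ℕ) (lam : Fin j → Fin (n - j + 1)) : Prop :=
  ∀ r r' : Fin j, r ≤ r' → (lam r' : ℕ) ≤ (lam r : ℕ)

lemma rowLen_mono {n j : ℕ} (hj : 1 ≤ j) {lam : Fin j → Fin (n - j + 1)} (h : Anti n j lam) :
    Monotone (rowLen n j hj lam) := by
  intro i i' hi
  apply h
  rw [Fin.le_def]; simp only; omega

lemma rowLen_le {n j : ℕ} (hj : 1 ≤ j) (lam : Fin j → Fin (n - j + 1)) (i : ℕ) :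
    rowLen n j hj lam i ≤ n - j := by
  unfold rowLen; omega

lemma RL_range {n j : ℕ} (hj : 1 ≤ j) (hjn : j < n) (lam : Fin j → Fin (n - j + 1)) :
    ∀ p ∈ RL (rowLen n j hj lam) j, p.1 + p.2 + 1 < n := by
  intro p hp
  rw [mem_RL] at hp
  have := rowLen_le hj lam p.1
  omega

lemma wOf_apply {n j : ℕ} (hj : 1 ≤ j) (hjn : j < n) {lam : Fin j → Fin (n - j + 1)}
    (h : Anti n j lam) (i : Fin n) (hi : (i : ℕ) < j) :
    (wOf n j hj lam i : ℕ) = i + rowLen n j hj lam i := by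
  rw [wOf, (transfer n ∅ _ (RL_range hj hjn lam)).1]
  exact (RL_empty _ (rowLen_mono hj h) j).1 i hi

lemma wOf_gr {n j : ℕ} (hj : 1 ≤ j) (hjn : j < n) {lam : Fin j → Fin (n - j + 1)}
    (h : Anti n j lam) : Gr n j (wOf n j hj lam) := by
  intro p q hpq hc
  rw [Fin.lt_def] at hpq ⊢
  rcases hc with hc | hc
  · rw [wOf_apply hj hjn h p (by omega), wOf_apply hj hjn h q hc]
    have := rowLen_mono hj h hpq.le
    omega
  · rw [wOf, (transfer n ∅ _ (RL_range hj hjn lam)).1, (transfer n ∅ _ (RL_range hj hjn lam)).1]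
    exact (RL_empty _ (rowLen_mono hj h) j).2 p q hc hpq

lemma wOf_inj {n j : ℕ} (hj : 1 ≤ j) (hjn : j < n) {lam lam' : Fin j → Fin (n - j + 1)}
    (h : Anti n j lam) (h' : Anti n j lam') (he : wOf n j hj lam = wOf n j hj lam') :
    lam = lam' := by
  funext r
  have hb : j - 1 - (r : ℕ) < n := by omega
  have h1 := wOf_apply hj hjn h ⟨j - 1 - r, hb⟩ (by simp only; omega)
  have h2 := wOf_apply hj hjn h' ⟨j - 1 - r, hb⟩ (by simp only; omega)
  rw [he, h2] at h1
  have e : (⟨j - 1 - (j - 1 - (r : ℕ)), by omega⟩ : Fin j) = r := by ext; simp only; omega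
  simp only [rowLen, e] at h1
  ext; omega

lemma wOf_surj {n j : ℕ} (hj : 1 ≤ j) (hjn : j < n) (w : Equiv.Perm (Fin n)) (hw : Gr n j w) :
    ∃ lam, Anti n j lam ∧ wOf n j hj lam = w := by
  have hlo : ∀ i : Fin n, (i : ℕ) < j → (i : ℕ) ≤ w i := by
    intro i hi
    have := gr_gap n j w hw ⟨0, by omega⟩ i (by rw [Fin.le_def]; simp) hi
    simp only at this; omega
  have hhi : ∀ i : Fin n, (i : ℕ) < j → (w i : ℕ) ≤ n - j + i := by
    intro i hi
    have := gr_gap n j w hw i ⟨j - 1, by omega⟩ (by rw [Fin.le_def]; simp only; omega)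
      (by simp only; omega)
    simp only at this
    have := (w ⟨j - 1, by omega⟩).2
    omega
  let lam : Fin j → Fin (n - j + 1) := fun r =>
    ⟨(w ⟨j - 1 - r, by omega⟩ : ℕ) - (j - 1 - r), by
      have := hhi ⟨j - 1 - r, by omega⟩ (by simp only; omega)
      simp only at this; omega⟩
  have hanti : Anti n j lam := by
    intro r r' hr
    rw [Fin.le_def] at hr
    simp only [lam]
    have := gr_gap n j w hw ⟨j - 1 - r', by omega⟩ ⟨j - 1 - r, by omega⟩
      (by rw [Fin.le_def]; simp only; omega) (by simp only; omega)
    simp only at this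
    omega
  refine ⟨lam, hanti, gr_unique n j _ _ (wOf_gr hj hjn hanti) hw fun p hp => ?_⟩
  ext
  rw [wOf_apply hj hjn hanti p hp]
  have e : (⟨j - 1 - (j - 1 - (p : ℕ)), by omega⟩ : Fin n) = p := by ext; simp only; omega
  have := hlo p hp
  simp only [rowLen, lam, e]
  omega

/-- A filling as a finset of boxes, rows flipped. -/
noncomputable def toT (n j : ℕ) (D : Fin j × Fin (n - j) → Bool) : Finset (ℕ × ℕ) :=
  (Finset.univ.filter fun p => D p = true).image fun p => (j - 1 - (p.1 : ℕ), (p.2 : ℕ))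

lemma mem_toT {n j : ℕ} (D : Fin j × Fin (n - j) → Bool) (i c : ℕ) :
    (i, c) ∈ toT n j D ↔ ∃ (hi : i < j) (hc : c < n - j),
      D (⟨j - 1 - i, by omega⟩, ⟨c, hc⟩) = true := by
  unfold toT
  simp only [Finset.mem_image, Finset.mem_filter, Finset.mem_univ, true_and, Prod.mk.injEq,
    Prod.exists]
  constructor
  · rintro ⟨r, c', h1, rfl, rfl⟩
    refine ⟨by omega, c'.2, ?_⟩
    rw [← h1]
    congr 2
    ext; simp only; omega
  · rintro ⟨hi, hc, h⟩
    exact ⟨_, _, h, by simp only; omega, rfl⟩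

lemma card_toT {n j : ℕ} (D : Fin j × Fin (n - j) → Bool) :
    (toT n j D).card = (Finset.univ.filter fun p => D p = true).card := by
  unfold toT
  apply Finset.card_image_of_injective
  rintro ⟨r, c⟩ ⟨r', c'⟩ h
  simp only [Prod.mk.injEq, Fin.ext_iff] at h ⊢
  omega

lemma le_iff {n j : ℕ} (hj : 1 ≤ j) (lam : Fin j → Fin (n - j + 1)) (h : Anti n j lam)
    (D : Fin j × Fin (n - j) → Bool) :
    IsLeDiagA n j lam D ↔ toT n j D ⊆ (RL (rowLen n j hj lam) j).toFinset ∧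
      LeUp (rowLen n j hj lam) j (toT n j D) := by
  have hflip : ∀ (r : Fin j) (c : Fin (n - j)), ((j - 1 - (r : ℕ), (c : ℕ)) ∈ toT n j D) ↔
      D (r, c) = true := by
    intro r c
    rw [mem_toT]
    have e : (⟨j - 1 - (j - 1 - (r : ℕ)), by omega⟩ : Fin j) = r := by ext; simp only; omega
    simp only [e]
    constructor
    · rintro ⟨_, _, h⟩; exact h
    · intro h; exact ⟨by omega, c.2, h⟩
  have hlen : ∀ r : Fin j, rowLen n j hj lam (j - 1 - r) = lam r := by
    intro r
    have e : (⟨j - 1 - (j - 1 - (r : ℕ)), by omega⟩ : Fin j) = r := by ext; simp only; omega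
    simp only [rowLen, e]
  constructor
  · rintro ⟨-, h2, h3⟩
    constructor
    · rintro ⟨i, c⟩ hp
      rw [mem_toT] at hp
      obtain ⟨hi, hc, hD⟩ := hp
      rw [List.mem_toFinset, mem_RL]
      refine ⟨hi, ?_⟩
      by_contra hcon
      have := h2 (⟨j - 1 - i, by omega⟩, ⟨c, hc⟩) hcon
      rw [hD] at this; cases this
    · intro i hi c hc hT i' hi' hc' hn c' hcc hT'
      obtain ⟨_, hcn, hD⟩ := (mem_toT D i c).1 hT
      obtain ⟨_, hcn', hD'⟩ := (mem_toT D i' c').1 hT'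
      refine h3 (⟨j - 1 - i', by omega⟩, ⟨c, hcn⟩) hc' ?_ ⟨⟨⟨j - 1 - i, by omega⟩, ?_, hD⟩,
        ⟨⟨c', hcn'⟩, ?_, hD'⟩⟩
      · rw [← Bool.not_eq_true]
        intro hD2
        exact hn ((mem_toT D i' c).2 ⟨by omega, hcn, hD2⟩)
      · rw [Fin.lt_def]; simp only; omega
      · exact hcc
  · rintro ⟨h1, h2⟩
    refine ⟨h, ?_, ?_⟩
    · rintro ⟨r, c⟩ hp
      rw [← Bool.not_eq_true, ← hflip]
      intro hm
      have := h1 hm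
      rw [List.mem_toFinset, mem_RL, hlen] at this
      exact hp this.2
    · rintro ⟨r, c⟩ hp hD ⟨⟨r', hr', hD1⟩, ⟨c', hc', hD2⟩⟩
      simp only at hp hr' hc' hD1 hD2
      rw [← hflip] at hD1 hD2
      rw [Fin.lt_def] at hr' hc'
      have := h1 hD1
      rw [List.mem_toFinset, mem_RL] at this
      refine h2 _ (by omega) c this.2 hD1 (j - 1 - r) (by omega) (by rwa [hlen]) ?_ c' hc' hD2
      rw [hflip, hD]; simp

open Polynomial in
lemma fixed_lam {n j : ℕ} (hj : 1 ≤ j) (hjn : j < n) (lam : Fin j → Fin (n - j + 1))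
    (h : Anti n j lam) :
    (∑ D : Fin j × Fin (n - j) → Bool, if IsLeDiagA n j lam D then
      (X : Polynomial ℤ) ^ (Finset.univ.filter fun p => D p = true).card else 0) =
    ∑ x, if bruhatA n x (wOf n j hj lam) then
        (X : Polynomial ℤ) ^ (invCount (wOf n j hj lam) - invCount x) else 0 := by
  have hpds : ∀ T, PDS n T (RL (rowLen n j hj lam) j) ↔ LeUp (rowLen n j hj lam) j T := fun T => by
    rw [(transfer n T _ (RL_range hj hjn lam)).2, (le_main _ (rowLen_mono hj h) T j).1]
  have := pds_sum' n (RL (rowLen n j hj lam) j) (nodup_RL _ _) (RL_range hj hjn lam)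
    ((hpds ∅).2 (by simp [LeUp]))
  have hback : ∀ T, T ⊆ (RL (rowLen n j hj lam) j).toFinset →
      toT n j (fun p => decide ((j - 1 - (p.1 : ℕ), (p.2 : ℕ)) ∈ T)) = T := by
    intro T hT
    ext ⟨i, c⟩
    rw [mem_toT]
    simp only [decide_eq_true_iff]
    constructor
    · rintro ⟨hi, hc, hm⟩
      rwa [show j - 1 - (j - 1 - i) = i by omega] at hm
    · intro hm
      have h1 := hT hm
      rw [List.mem_toFinset, mem_RL] at h1
      have := rowLen_le hj lam i
      simp only at h1
      refine ⟨h1.1, by omega, ?_⟩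
      rwa [show j - 1 - (j - 1 - i) = i by omega]
  rw [wOf, ← this, ← Finset.sum_filter, ← Finset.sum_filter]
  refine Finset.sum_bij' (fun D _ => toT n j D)
    (fun T _ => fun p => decide ((j - 1 - (p.1 : ℕ), (p.2 : ℕ)) ∈ T)) ?_ ?_ ?_ ?_ ?_
  · intro D hD
    rw [Finset.mem_filter] at hD
    rw [Finset.mem_filter, Finset.mem_powerset, hpds]
    exact (le_iff hj lam h D).1 hD.2
  · intro T hT
    rw [Finset.mem_filter, Finset.mem_powerset, hpds] at hT
    rw [Finset.mem_filter, le_iff hj lam h, hback T hT.1]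
    exact ⟨Finset.mem_univ _, hT⟩
  · intro D hD
    funext ⟨r, c⟩
    rw [Bool.eq_iff_iff, decide_eq_true_iff, mem_toT]
    have e : (⟨j - 1 - (j - 1 - (r : ℕ)), by omega⟩ : Fin j) = r := by ext; simp only; omega
    simp only [e]
    constructor
    · rintro ⟨_, _, h⟩; exact h
    · intro h; exact ⟨by omega, c.2, h⟩
  · intro T hT
    rw [Finset.mem_filter, Finset.mem_powerset] at hT
    exact hback T hT.1
  · intro D _
    rw [card_toT]

open Polynomial in
/-- The `q`-count of Le-diagrams contained in the `j × (n-j)` rectangle, weighted by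
`q^(number of +'s)`, equals the `q`-count of pairs `(x, w)` with `x ≤ w` in Bruhat order
and `w` a minimal length coset representative of `S_n / ⟨s_1, …, ŝ_j, …, s_{n-1}⟩`,
weighted by `q^(ℓ(w) − ℓ(x))`. -/
theorem Le_diagram_q_count (n j : ℕ) (hj : 1 ≤ j) (hjn : j < n) :
    (∑ x : {y : (Fin j → Fin (n - j + 1)) × (Fin j × Fin (n - j) → Bool) //
        IsLeDiagA n j y.1 y.2},
      (X : Polynomial ℤ) ^ (Finset.univ.filter fun p => x.1.2 p = true).card) =
    ∑ vw : {y : Equiv.Perm (Fin n) × Equiv.Perm (Fin n) //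
        bruhatA n y.1 y.2 ∧ IsMinRep n j y.2},
      (X : Polynomial ℤ) ^ (invCount vw.1.2 - invCount vw.1.1) := by
  have hL : (∑ x : {y : (Fin j → Fin (n - j + 1)) × (Fin j × Fin (n - j) → Bool) //
        IsLeDiagA n j y.1 y.2},
      (X : Polynomial ℤ) ^ (Finset.univ.filter fun p => x.1.2 p = true).card) =
      ∑ lam ∈ Finset.univ.filter (fun lam => Anti n j lam),
        ∑ x, if bruhatA n x (wOf n j hj lam) then
          (X : Polynomial ℤ) ^ (invCount (wOf n j hj lam) - invCount x) else 0 := by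
    rw [← Finset.sum_subtype (Finset.univ.filter
      (fun y : (Fin j → Fin (n - j + 1)) × (Fin j × Fin (n - j) → Bool) => IsLeDiagA n j y.1 y.2))
      (by simp) (fun y : (Fin j → Fin (n - j + 1)) × (Fin j × Fin (n - j) → Bool) =>
        (X : Polynomial ℤ) ^ (Finset.univ.filter fun p => y.2 p = true).card)]
    rw [Finset.sum_filter, Fintype.sum_prod_type, Finset.sum_filter]
    refine Finset.sum_congr rfl fun lam _ => ?_
    split_ifs with h
    · exact fixed_lam hj hjn lam h
    · refine Finset.sum_eq_zero fun D _ => if_neg ?_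
      exact fun h' => h h'.1
  have hR : (∑ vw : {y : Equiv.Perm (Fin n) × Equiv.Perm (Fin n) //
        bruhatA n y.1 y.2 ∧ IsMinRep n j y.2},
      (X : Polynomial ℤ) ^ (invCount vw.1.2 - invCount vw.1.1)) =
      ∑ w ∈ Finset.univ.filter (fun w => IsMinRep n j w),
        ∑ x, if bruhatA n x w then
          (X : Polynomial ℤ) ^ (invCount w - invCount x) else 0 := by
    rw [← Finset.sum_subtype (Finset.univ.filter
      (fun y : Equiv.Perm (Fin n) × Equiv.Perm (Fin n) => bruhatA n y.1 y.2 ∧ IsMinRep n j y.2))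
      (by simp) (fun y : Equiv.Perm (Fin n) × Equiv.Perm (Fin n) =>
        (X : Polynomial ℤ) ^ (invCount y.2 - invCount y.1))]
    rw [Finset.sum_filter, Fintype.sum_prod_type_right, Finset.sum_filter]
    refine Finset.sum_congr rfl fun w _ => ?_
    split_ifs with h
    · refine Finset.sum_congr rfl fun x _ => ?_
      simp [h]
    · refine Finset.sum_eq_zero fun x _ => if_neg ?_
      exact fun h' => h h'.2
  rw [hL, hR]
  refine Finset.sum_bij (fun lam _ => wOf n j hj lam) ?_ ?_ ?_ ?_
  · intro lam h
    rw [Finset.mem_filter] at h ⊢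
    exact ⟨Finset.mem_univ _, (minrep_iff _ _ _).2 (wOf_gr hj hjn h.2)⟩
  · intro lam h lam' h' he
    rw [Finset.mem_filter] at h h'
    exact wOf_inj hj hjn h.2 h'.2 he
  · intro w hw
    rw [Finset.mem_filter, minrep_iff] at hw
    obtain ⟨lam, h1, h2⟩ := wOf_surj hj hjn w hw.2
    exact ⟨lam, by rw [Finset.mem_filter]; exact ⟨Finset.mem_univ _, h1⟩, h2⟩
  · intro lam _
    rfl
end
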